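/- arXiv:1303.1790 — 2 statements merged into one kernel-verified Lean document; each statement's English description precedes it below -/
import Mathlib

section
/- Let m ≥ 1, T > 0, m₀ > 0, J₀ ∈ ℝ^{3×3}, and matrices M, J, N ∈ ℝ^{3×3}, C^M, C^J ∈ ℝ^{3×m}, and for p = 1,…,m, L_p^M, R_p^M, L_p^J, R_p^J ∈ ℝ^{3×3}, W_p^M, W_p^J ∈ ℝ^{3×m}, with 𝒥 = [[m₀ Id + M, N], [Nᵀ, J₀ + J]] invertible. Set C = −[C^M; C^J] and let F be the associated quadratic map. Suppose (h̄, l̄, w̄) ∈ C^∞([0,T]; ℝ³ × ℝ³ × ℝ^m) are such that the tuple (h̄, 0, l̄, 0, w̄) (i.e., with q⃗ ≡ 0 and r ≡ 0) solves the control system h' = (1−‖q⃗‖²) l + 2√(1−‖q⃗‖²) q⃗ × l + (l·q⃗) q⃗ − q⃗ × l × q⃗, q⃗' = ½(√(1−‖q⃗‖²) r + q⃗ × r), (l,r)' = 𝒥⁻¹(C w' + F(l,r,w)), with h̄(0) = h̄(T) = 0, l̄(0) = l̄(T) = 0 and w̄(0) = 0. Let A(t) ∈ ℝ^{6×6} and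 B(t) ∈ ℝ^{6×m} be the partial derivatives of F with respect to (l,r) and to w evaluated at (l̄(t), 0, w̄(t)), and assume the linear time-varying system ĥ' = l̂ + 2 q̂⃗ × l̄(t), q̂⃗' = ½ r̂, (l̂, r̂)' = 𝒥⁻¹(A(t)(l̂; r̂) + B(t) f + C f') is controllable on [0,T] with controls f ∈ C¹([0,T]; ℝ^m) satisfying f(0) = 0. Then the nonlinear system is locally controllable around the origin in time T: there exists η > 0 such that for all states (h₀, q⃗₀, l₀, r₀) and (h_T, q⃗_T, l_T, r_T) in ℝ¹² of norm less than η, there exists a control w ∈ C¹([0,T]; ℝ^m) with w(0) = 0 such that the solution of the nonlinear system with control w and initial state (h₀, q⃗₀, l₀, r₀) at t = 0 is defined on [0,T] and has state (h_T, q⃗_T, l_T, r_T) at t = T. -/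
noncomputable section

open Matrix

/-- The skew-symmetric matrix `S(y)` with `S(y) x = y × x`. -/
def Smat (y : Fin 3 → ℝ) : Matrix (Fin 3) (Fin 3) ℝ :=
  !![0, -y 2, y 1; y 2, 0, -y 0; -y 1, y 0, 0]

/-- The virtual inertia matrix `𝒥 = [[m₀ Id + M, N], [Nᵀ, J₀ + J]]`. -/
def Jcal (m₀ : ℝ) (J₀ M J N : Matrix (Fin 3) (Fin 3) ℝ) :
    Matrix (Fin 3 ⊕ Fin 3) (Fin 3 ⊕ Fin 3) ℝ :=
  Matrix.fromBlocks (m₀ • (1 : Matrix (Fin 3) (Fin 3) ℝ) + M) N Nᵀ (J₀ + J)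

/-- Vertical stacking of two `3 × m` matrices into a `6 × m` matrix. -/
def stackM {m : ℕ} (A B : Matrix (Fin 3) (Fin m) ℝ) :
    Matrix (Fin 3 ⊕ Fin 3) (Fin m) ℝ :=
  Matrix.of fun i j => Sum.elim (fun a => A a j) (fun a => B a j) i

/-- The control matrix `C = −[Cᴹ; Cᴶ]`. -/
def Cmat {m : ℕ} (CM CJ : Matrix (Fin 3) (Fin m) ℝ) :
    Matrix (Fin 3 ⊕ Fin 3) (Fin m) ℝ := -(stackM CM CJ)

/-- The quadratic map
`F(l,r,w) = −[[S(r),0],[S(l),S(r)]] (𝒥 (l;r) − C w)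
  − Σ_p w_p (Lᴹ_p l + Rᴹ_p r + Wᴹ_p w ; Lᴶ_p l + Rᴶ_p r + Wᴶ_p w)`. -/
def Fquad {m : ℕ} (m₀ : ℝ) (J₀ M J N : Matrix (Fin 3) (Fin 3) ℝ)
    (CM CJ : Matrix (Fin 3) (Fin m) ℝ)
    (LM RM LJ RJ : Fin m → Matrix (Fin 3) (Fin 3) ℝ)
    (WM WJ : Fin m → Matrix (Fin 3) (Fin m) ℝ)
    (l r : Fin 3 → ℝ) (w : Fin m → ℝ) : Fin 3 ⊕ Fin 3 → ℝ :=
  -((Matrix.fromBlocks (Smat r) 0 (Smat l) (Smat r)).mulVec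
      ((Jcal m₀ J₀ M J N).mulVec (Sum.elim l r) - (Cmat CM CJ).mulVec w))
  - ∑ p : Fin m, w p • Sum.elim
      ((LM p).mulVec l + (RM p).mulVec r + (WM p).mulVec w)
      ((LJ p).mulVec l + (RJ p).mulVec r + (WJ p).mulVec w)

/-- Right-hand side of the equation for `h`:
`(1−‖q‖²) l + 2√(1−‖q‖²) q × l + (l·q) q − q × (l × q)`. -/
def rhsH (q l : Fin 3 → ℝ) : Fin 3 → ℝ :=
  (1 - ∑ i, q i ^ 2) • l
    + (2 * Real.sqrt (1 - ∑ i, q i ^ 2)) • crossProduct q l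
    + (∑ i, l i * q i) • q
    - crossProduct q (crossProduct l q)

/-- Right-hand side of the equation for `q⃗`: `½(√(1−‖q‖²) r + q × r)`. -/
def rhsQ (q r : Fin 3 → ℝ) : Fin 3 → ℝ :=
  (1 / 2 : ℝ) • (Real.sqrt (1 - ∑ i, q i ^ 2) • r + crossProduct q r)


/-- The stacked form of `F`, as a function of `k = (l;r) ∈ ℝ⁶` and `w ∈ ℝ^m`. -/
def Fstack {m : ℕ} (m₀ : ℝ) (J₀ M J N : Matrix (Fin 3) (Fin 3) ℝ)
    (CM CJ : Matrix (Fin 3) (Fin m) ℝ)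
    (LM RM LJ RJ : Fin m → Matrix (Fin 3) (Fin 3) ℝ)
    (WM WJ : Fin m → Matrix (Fin 3) (Fin m) ℝ)
    (k : Fin 3 ⊕ Fin 3 → ℝ) (w : Fin m → ℝ) : Fin 3 ⊕ Fin 3 → ℝ :=
  Fquad m₀ J₀ M J N CM CJ LM RM LJ RJ WM WJ
    (fun a => k (Sum.inl a)) (fun a => k (Sum.inr a)) w

/-- The matrix `A(t) = ∂F/∂(l,r)` evaluated at `(l̄, 0, w̄)`. -/
def Amat {m : ℕ} (m₀ : ℝ) (J₀ M J N : Matrix (Fin 3) (Fin 3) ℝ)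
    (CM CJ : Matrix (Fin 3) (Fin m) ℝ)
    (LM RM LJ RJ : Fin m → Matrix (Fin 3) (Fin 3) ℝ)
    (WM WJ : Fin m → Matrix (Fin 3) (Fin m) ℝ)
    (lbar : Fin 3 → ℝ) (wbar : Fin m → ℝ) :
    Matrix (Fin 3 ⊕ Fin 3) (Fin 3 ⊕ Fin 3) ℝ :=
  Matrix.of fun i j =>
    fderiv ℝ (fun k : Fin 3 ⊕ Fin 3 → ℝ =>
        Fstack m₀ J₀ M J N CM CJ LM RM LJ RJ WM WJ k wbar i)
      (Sum.elim lbar (0 : Fin 3 → ℝ)) (Pi.single j 1)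

/-- The matrix `B(t) = ∂F/∂w` evaluated at `(l̄, 0, w̄)`. -/
def Bmat {m : ℕ} (m₀ : ℝ) (J₀ M J N : Matrix (Fin 3) (Fin 3) ℝ)
    (CM CJ : Matrix (Fin 3) (Fin m) ℝ)
    (LM RM LJ RJ : Fin m → Matrix (Fin 3) (Fin 3) ℝ)
    (WM WJ : Fin m → Matrix (Fin 3) (Fin m) ℝ)
    (lbar : Fin 3 → ℝ) (wbar : Fin m → ℝ) :
    Matrix (Fin 3 ⊕ Fin 3) (Fin m) ℝ :=
  Matrix.of fun i j =>
    fderiv ℝ (fun w : Fin m → ℝ =>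
        Fstack m₀ J₀ M J N CM CJ LM RM LJ RJ WM WJ
          (Sum.elim lbar (0 : Fin 3 → ℝ)) w i)
      wbar (Pi.single j 1)

section RetAbstract

set_option linter.unusedSectionVars false

open Set Filter Topology MeasureTheory

variable {E F P V : Type*} [NormedAddCommGroup E] [NormedSpace ℝ E]
  [NormedAddCommGroup F] [NormedSpace ℝ F] [NormedAddCommGroup P] [NormedSpace ℝ P]
  [NormedAddCommGroup V] [NormedSpace ℝ V]

/-- Pointwise application of a continuous family of continuous linear maps. -/
def retMul {K : Type*} [TopologicalSpace K] [CompactSpace K] (A : C(K, P →L[ℝ] E)) :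
    C(K, P) →L[ℝ] C(K, E) :=
  LinearMap.mkContinuous
    { toFun := fun y => ⟨fun t => A t (y t), A.continuous.clm_apply y.continuous⟩
      map_add' := by intro x y; ext t; simp
      map_smul' := by intro c y; ext t; simp } ‖A‖ (by
    intro y
    refine (ContinuousMap.norm_le _ (by positivity)).2 fun t => ?_
    exact ((A t).le_opNorm _).trans (mul_le_mul (A.norm_coe_le_norm t) (y.norm_coe_le_norm t)
      (norm_nonneg _) (norm_nonneg A)))

@[simp] lemma retMul_apply {K : Type*} [TopologicalSpace K] [CompactSpace K]
    (A : C(K, P →L[ℝ] E)) (y : C(K, P)) (t : K) : retMul A y t = A t (y t) := rfl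

/-- Strict differentiability of the superposition operator. -/
lemma ret_nemytskii {K : Type*} [TopologicalSpace K] [CompactSpace K] (G : C(P, E))
    (y : C(K, P)) (A : C(K, P →L[ℝ] E)) (hG : ∀ t, HasStrictFDerivAt G (A t) (y t)) :
    HasStrictFDerivAt (fun z : C(K, P) => G.comp z) (retMul A) y := by
  refine .of_isLittleO ?_
  rw [Asymptotics.isLittleO_iff]
  intro c hc
  have key : ∀ᶠ z : P × P in 𝓝 (0, 0), ∀ t ∈ (univ : Set K),
      ‖G (y t + z.1) - G (y t + z.2) - A t (z.1 - z.2)‖ ≤ c * ‖z.1 - z.2‖ := by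
    refine isCompact_univ.eventually_forall_of_forall_eventually fun t₀ _ => ?_
    have h1 := (hG t₀).isLittleO
    rw [Asymptotics.isLittleO_iff] at h1
    have h1 := h1 (half_pos hc)
    have h2 : Tendsto (fun q : (P × P) × K => (y q.2 + q.1.1, y q.2 + q.1.2))
        (𝓝 ((0, 0), t₀)) (𝓝 (y t₀, y t₀)) := by
      have : Continuous (fun q : (P × P) × K => (y q.2 + q.1.1, y q.2 + q.1.2)) := by fun_prop
      have h := this.tendsto ((0, 0), t₀)
      simpa using h
    have h3 : ∀ᶠ q : (P × P) × K in 𝓝 ((0, 0), t₀), ‖A q.2 - A t₀‖ < c / 2 := by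
      have : Continuous (fun q : (P × P) × K => ‖A q.2 - A t₀‖) := by fun_prop
      have h := this.tendsto ((0, 0), t₀)
      simp only [sub_self, norm_zero] at h
      exact h.eventually (gt_mem_nhds (half_pos hc))
    filter_upwards [h2.eventually h1, h3] with q hq1 hq2
    simp only [add_sub_add_left_eq_sub] at hq1
    have e : G (y q.2 + q.1.1) - G (y q.2 + q.1.2) - A q.2 (q.1.1 - q.1.2)
        = (G (y q.2 + q.1.1) - G (y q.2 + q.1.2) - A t₀ (q.1.1 - q.1.2))
          - (A q.2 - A t₀) (q.1.1 - q.1.2) := by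
      rw [_root_.sub_apply]; abel
    rw [e]
    calc _ ≤ c / 2 * ‖q.1.1 - q.1.2‖ + c / 2 * ‖q.1.1 - q.1.2‖ :=
          (norm_sub_le _ _).trans (add_le_add hq1
            (((A q.2 - A t₀).le_opNorm _).trans (by gcongr)))
      _ = _ := by ring
  rw [Metric.eventually_nhds_iff] at key
  obtain ⟨δ, hδ, key⟩ := key
  rw [Metric.eventually_nhds_iff]
  refine ⟨δ, hδ, fun p hp => ?_⟩
  refine (ContinuousMap.norm_le _ (by positivity)).2 fun t => ?_
  have hp1 : dist p.1 y < δ := (le_max_left _ _).trans_lt hp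
  have hp2 : dist p.2 y < δ := (le_max_right _ _).trans_lt hp
  have h := @key (p.1 t - y t, p.2 t - y t) (by
    rw [Prod.dist_eq]
    simp only [dist_zero_right]
    refine max_lt ?_ ?_
    · rw [← dist_eq_norm]; exact (ContinuousMap.dist_apply_le_dist t).trans_lt hp1
    · rw [← dist_eq_norm]; exact (ContinuousMap.dist_apply_le_dist t).trans_lt hp2) t (mem_univ _)
  simp only [add_sub_cancel, sub_sub_sub_cancel_right] at h
  refine h.trans ?_
  gcongr
  exact (p.1 - p.2).norm_coe_le_norm t

variable {T : ℝ}

/-- Extension to the line of a function on `[0,T]`. -/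
def retExt (hT : 0 < T) (f : C(Icc (0:ℝ) T, E)) : ℝ → E := IccExtend hT.le f

lemma retExt_cont (hT : 0 < T) (f : C(Icc (0:ℝ) T, E)) : Continuous (retExt hT f) :=
  f.continuous.Icc_extend'

lemma retExt_eq (hT : 0 < T) (f : C(Icc (0:ℝ) T, E)) {t : ℝ} (ht : t ∈ Icc 0 T) :
    retExt hT f t = f ⟨t, ht⟩ := IccExtend_of_mem _ _ ht

lemma retExt_norm (hT : 0 < T) (f : C(Icc (0:ℝ) T, E)) (t : ℝ) :
    ‖retExt hT f t‖ ≤ ‖f‖ := f.norm_coe_le_norm _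

/-- Integration from `0`. -/
def retInt [CompleteSpace E] (hT : 0 < T) : C(Icc (0:ℝ) T, E) →L[ℝ] C(Icc (0:ℝ) T, E) :=
  LinearMap.mkContinuous
    { toFun := fun f => ⟨fun t => ∫ s in (0:ℝ)..t, retExt hT f s,
        (intervalIntegral.continuous_primitive
          (fun a b => (retExt_cont hT f).intervalIntegrable a b) 0).comp continuous_subtype_val⟩
      map_add' := by
        intro f g; ext t
        simp only [ContinuousMap.coe_mk, ContinuousMap.add_apply]
        rw [← intervalIntegral.integral_add ((retExt_cont hT f).intervalIntegrable _ _)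
          ((retExt_cont hT g).intervalIntegrable _ _)]
        rfl
      map_smul' := by
        intro c f; ext t
        simp only [ContinuousMap.coe_mk, ContinuousMap.smul_apply, RingHom.id_apply]
        rw [← intervalIntegral.integral_smul]
        rfl } T (by
    intro f
    refine (ContinuousMap.norm_le _ (by positivity)).2 fun t => ?_
    have h := intervalIntegral.norm_integral_le_of_norm_le_const (a := 0) (b := (t:ℝ))
      (f := retExt hT f) (C := ‖f‖) (fun s _ => retExt_norm hT f s)
    refine h.trans ?_
    rw [sub_zero, abs_of_nonneg t.2.1, mul_comm]
    exact mul_le_mul_of_nonneg_right t.2.2 (norm_nonneg _))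

lemma retInt_apply [CompleteSpace E] (hT : 0 < T) (f : C(Icc (0:ℝ) T, E)) (t : Icc (0:ℝ) T) :
    retInt hT f t = ∫ s in (0:ℝ)..t, retExt hT f s := rfl

lemma ret_volterra_bound [CompleteSpace E] (hT : 0 < T) (A : C(Icc (0:ℝ) T, E →L[ℝ] E))
    (g : C(Icc (0:ℝ) T, E)) (n : ℕ) : ∀ t : Icc (0:ℝ) T,
    ‖(((retInt hT).comp (retMul A)) ^ n) g t‖ ≤ ‖A‖ ^ n * (t:ℝ) ^ n / n.factorial * ‖g‖ := by
  induction n with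
  | zero => intro t; simpa using g.norm_coe_le_norm t
  | succ n ih =>
    intro t
    rw [pow_succ', mul_apply_eq_comp, ContinuousLinearMap.comp_apply, retInt_apply]
    set u := (((retInt hT).comp (retMul A)) ^ n) g
    have hb : ∀ s ∈ Icc (0:ℝ) t, ‖retExt hT (retMul A u) s‖
        ≤ ‖A‖ ^ (n+1) / n.factorial * ‖g‖ * s ^ n := by
      intro s hs
      rw [retExt_eq hT _ ⟨hs.1, hs.2.trans t.2.2⟩, retMul_apply]
      refine ((A _).le_opNorm _).trans ?_
      refine (mul_le_mul (A.norm_coe_le_norm _) (ih _) (norm_nonneg _) (norm_nonneg _)).trans_eq ?_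
      simp only [pow_succ]; ring
    have h2 := intervalIntegral.norm_integral_le_of_norm_le (a := 0) (b := (t:ℝ)) (μ := volume)
      (f := retExt hT (retMul A u)) (g := fun s => ‖A‖ ^ (n+1) / n.factorial * ‖g‖ * s ^ n) t.2.1
      (Eventually.of_forall fun s hs => hb s ⟨hs.1.le, hs.2⟩)
      (Continuous.intervalIntegrable (by fun_prop) _ _)
    refine h2.trans_eq ?_
    rw [intervalIntegral.integral_const_mul, integral_pow]
    have := n.factorial_pos
    rw [Nat.factorial_succ]
    push_cast
    field_simp
    ring

lemma ret_volterra [CompleteSpace E] (hT : 0 < T) (A : C(Icc (0:ℝ) T, E →L[ℝ] E))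
    (g : C(Icc (0:ℝ) T, E)) : ∃ ξ : C(Icc (0:ℝ) T, E), ξ - retInt hT (retMul A ξ) = g := by
  set K := (retInt (E := E) hT).comp (retMul A) with hK
  obtain ⟨n, hn⟩ := ((FloorSemiring.tendsto_pow_div_factorial_atTop (‖A‖ * T)).eventually
    (gt_mem_nhds (show (0:ℝ) < 1 / 2 by norm_num))).exists
  have hKn : ‖K ^ n‖ < 1 := by
    refine lt_of_le_of_lt (ContinuousLinearMap.opNorm_le_bound _ (M := 1/2) (by norm_num)
      fun g => ?_) (by norm_num)
    refine (ContinuousMap.norm_le _ (by positivity)).2 fun t => ?_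
    refine (ret_volterra_bound hT A g n t).trans ?_
    refine mul_le_mul_of_nonneg_right ?_ (norm_nonneg _)
    refine le_trans ?_ hn.le
    rw [mul_pow]
    have := t.2.1
    have := t.2.2
    gcongr
  obtain ⟨u, hu⟩ :=
    isUnit_one_sub_of_norm_lt_one (R := C(Icc (0:ℝ) T, E) →L[ℝ] C(Icc (0:ℝ) T, E)) hKn
  let L : C(Icc (0:ℝ) T, E) →L[ℝ] C(Icc (0:ℝ) T, E) := (∑ i ∈ Finset.range n, K ^ i) * ↑u⁻¹
  have h1 : (1 - K) * L = 1 := by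
    simp only [L]
    rw [← mul_assoc, mul_neg_geom_sum, ← hu, Units.mul_inv]
  refine ⟨L g, ?_⟩
  exact congrArg (fun L => L g) h1

/-- The linear map `(x, v) ↦ (x, ∫ v, v)`. -/
def retLam [CompleteSpace V] (hT : 0 < T) :
    (C(Icc (0:ℝ) T, E) × C(Icc (0:ℝ) T, V)) →L[ℝ] C(Icc (0:ℝ) T, E × V × V) :=
  ((ContinuousLinearMap.inl ℝ E (V × V)).compLeftContinuous ℝ _).comp
      (ContinuousLinearMap.fst ℝ _ _)
  + (((ContinuousLinearMap.inr ℝ E (V × V)).comp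
        (ContinuousLinearMap.inl ℝ V V)).compLeftContinuous ℝ _).comp
      ((retInt hT).comp (ContinuousLinearMap.snd ℝ _ _))
  + (((ContinuousLinearMap.inr ℝ E (V × V)).comp
        (ContinuousLinearMap.inr ℝ V V)).compLeftContinuous ℝ _).comp
      (ContinuousLinearMap.snd ℝ _ _)

lemma retLam_apply [CompleteSpace V] (hT : 0 < T)
    (x : C(Icc (0:ℝ) T, E)) (v : C(Icc (0:ℝ) T, V)) (t : Icc (0:ℝ) T) :
    retLam hT (x, v) t = (x t, retInt hT v t, v t) := by
  simp [retLam]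

/-- A function with continuous derivative on `[0,T]` is recovered by integration. -/
lemma ret_ftc [CompleteSpace E] (hT : 0 < T) (x : ℝ → E) (v : C(Icc (0:ℝ) T, E))
    (h : ∀ t (ht : t ∈ Icc (0:ℝ) T), HasDerivAt x (v ⟨t, ht⟩) t) (t : Icc (0:ℝ) T) :
    retInt hT v t = x t - x 0 := by
  rw [retInt_apply]
  refine intervalIntegral.integral_eq_sub_of_hasDerivAt (fun s hs => ?_)
    ((retExt_cont hT v).intervalIntegrable _ _)
  rw [uIcc_of_le t.2.1] at hs
  have hs' : s ∈ Icc (0:ℝ) T := ⟨hs.1, hs.2.trans t.2.2⟩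
  rw [retExt_eq hT v hs']
  exact h s hs'

/-- Local controllability from linearized controllability. -/
lemma ret_main [CompleteSpace E] [CompleteSpace V] (hT : 0 < T) (G : E × V × V → E)
    (hGc : Continuous G) (xb : ℝ → E) (wb vb : ℝ → V)
    (hvb : ContinuousOn vb (Icc 0 T))
    (hG : ∀ t ∈ Icc (0:ℝ) T, ContDiffAt ℝ 1 G (xb t, wb t, vb t))
    (hxb : ∀ t ∈ Icc (0:ℝ) T, HasDerivAt xb (G (xb t, wb t, vb t)) t)
    (hwb : ∀ t ∈ Icc (0:ℝ) T, HasDerivAt wb (vb t) t)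
    (hx0 : xb 0 = 0) (hxT : xb T = 0) (hw0 : wb 0 = 0)
    (hlin : ∀ b : E, ∃ (x : ℝ → E) (w v : ℝ → V), w 0 = 0 ∧ ContinuousOn v (Icc 0 T) ∧
      (∀ t ∈ Icc (0:ℝ) T, HasDerivAt w (v t) t) ∧
      (∀ t ∈ Icc (0:ℝ) T, HasDerivAt x (fderiv ℝ G (xb t, wb t, vb t) (x t, w t, v t)) t) ∧
      x 0 = 0 ∧ x T = b) :
    ∀ᶠ p : E × E in 𝓝 0, ∃ (x : ℝ → E) (w v : ℝ → V), w 0 = 0 ∧ ContinuousOn v (Icc 0 T) ∧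
      (∀ t ∈ Icc (0:ℝ) T, HasDerivAt w (v t) t) ∧
      (∀ t ∈ Icc (0:ℝ) T, HasDerivAt x (G (x t, w t, v t)) t) ∧
      x 0 = p.1 ∧ x T = p.2 := by
  have hxbc : ContinuousOn xb (Icc 0 T) := fun t ht => (hxb t ht).continuousAt.continuousWithinAt
  have hwbc : ContinuousOn wb (Icc 0 T) := fun t ht => (hwb t ht).continuousAt.continuousWithinAt
  let XB : C(Icc (0:ℝ) T, E) := ⟨fun t => xb t, continuousOn_iff_continuous_domRestrict.1 hxbc⟩
  let VB : C(Icc (0:ℝ) T, V) := ⟨fun t => vb t, continuousOn_iff_continuous_domRestrict.1 hvb⟩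
  have hWB : ∀ t, retInt hT VB t = wb t := fun t => by
    rw [ret_ftc hT wb VB (fun t ht => hwb t ht) t, hw0, sub_zero]
  have hYB : ∀ t, retLam hT (XB, VB) t = (xb t, wb t, vb t) := fun t => by
    rw [retLam_apply, hWB]; rfl
  let A : C(Icc (0:ℝ) T, (E × V × V) →L[ℝ] E) :=
    ⟨fun t => fderiv ℝ G (retLam hT (XB, VB) t), by
      rw [continuous_iff_continuousAt]
      intro t
      have h : ContinuousAt (fderiv ℝ G) (retLam hT (XB, VB) t) := by
        rw [hYB]; exact (hG t t.2).continuousAt_fderiv (by norm_num)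
      exact h.comp (retLam hT (XB, VB)).continuous.continuousAt⟩
  have hN := ret_nemytskii ⟨G, hGc⟩ (retLam hT (XB, VB)) A (fun t => by
    have := hG t t.2
    rw [← hYB] at this
    exact this.hasStrictFDerivAt (by norm_num))
  let T1 : Icc (0:ℝ) T := ⟨T, hT.le, le_rfl⟩
  let Φ : C(Icc (0:ℝ) T, E) × C(Icc (0:ℝ) T, V) → C(Icc (0:ℝ) T, E) × E := fun z =>
    (z.1 - retInt hT (ContinuousMap.comp ⟨G, hGc⟩ (retLam hT z)), z.1 T1)
  let Φ' : (C(Icc (0:ℝ) T, E) × C(Icc (0:ℝ) T, V)) →L[ℝ] C(Icc (0:ℝ) T, E) × E :=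
    (ContinuousLinearMap.fst ℝ _ _ - (retInt hT).comp ((retMul A).comp (retLam hT))).prod
      ((ContinuousMap.evalCLM ℝ T1).comp (ContinuousLinearMap.fst ℝ _ _))
  have hΦ : HasStrictFDerivAt Φ Φ' (XB, VB) := by
    refine HasStrictFDerivAt.prodMk ?_ ?_
    · refine hasStrictFDerivAt_fst.sub ?_
      have i1 : HasStrictFDerivAt (fun z : C(Icc (0:ℝ) T, E) => retInt hT z) (retInt hT)
          (ContinuousMap.comp ⟨G, hGc⟩ (retLam hT (XB, VB))) :=
        ContinuousLinearMap.hasStrictFDerivAt (𝕜 := ℝ) (E := C(Icc (0:ℝ) T, E))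
          (F := C(Icc (0:ℝ) T, E)) (retInt hT)
      have i2 : HasStrictFDerivAt (fun z => retLam hT z) (retLam hT) (XB, VB) :=
        ContinuousLinearMap.hasStrictFDerivAt (𝕜 := ℝ)
          (E := C(Icc (0:ℝ) T, E) × C(Icc (0:ℝ) T, V))
          (F := C(Icc (0:ℝ) T, E × V × V)) (retLam hT)
      exact i1.comp (XB, VB) (hN.comp (XB, VB) i2)
    · exact ContinuousLinearMap.hasStrictFDerivAt (𝕜 := ℝ)
          (E := C(Icc (0:ℝ) T, E) × C(Icc (0:ℝ) T, V)) (F := E)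
          ((ContinuousMap.evalCLM ℝ T1).comp (ContinuousLinearMap.fst ℝ _ _))
  have hsurj : Φ'.range = ⊤ := by
    rw [LinearMap.range_eq_top]
    rintro ⟨g, b⟩
    let A0 : C(Icc (0:ℝ) T, E →L[ℝ] E) :=
      ⟨fun t => (A t).comp (ContinuousLinearMap.inl ℝ E (V × V)), by fun_prop⟩
    obtain ⟨ξ, hξ⟩ := ret_volterra hT A0 g
    obtain ⟨x, w, v, h1, h2, h3, h4, h5, h6⟩ := hlin (b - ξ T1)
    have hxc : ContinuousOn x (Icc 0 T) := fun t ht => (h4 t ht).continuousAt.continuousWithinAt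
    let X : C(Icc (0:ℝ) T, E) := ⟨fun t => x t, continuousOn_iff_continuous_domRestrict.1 hxc⟩
    let U : C(Icc (0:ℝ) T, V) := ⟨fun t => v t, continuousOn_iff_continuous_domRestrict.1 h2⟩
    have hW : ∀ t, retInt hT U t = w t := fun t => by
      rw [ret_ftc hT w U (fun t ht => h3 t ht) t, h1, sub_zero]
    have hX : ∀ t, retInt hT (retMul A (retLam hT (X, U))) t = x t := fun t => by
      rw [ret_ftc hT x _ (fun t ht => ?_) t, h5, sub_zero]
      have := h4 t ht
      rw [retMul_apply, retLam_apply, hW]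
      have e : A ⟨t, ht⟩ = fderiv ℝ G (xb t, wb t, vb t) := by
        change fderiv ℝ G (retLam hT (XB, VB) ⟨t, ht⟩) = _
        rw [hYB]
      rw [e]
      exact this
    have hξ0 : retMul A (retLam hT (ξ, 0)) = retMul A0 ξ := by
      ext t
      rw [retMul_apply, retLam_apply, map_zero]
      rfl
    have e1 : Φ' (ξ, 0) = (g, ξ T1) := by
      rw [← hξ, ← hξ0]; rfl
    have e2 : Φ' (X, U) = (0, b - ξ T1) := by
      refine Prod.ext ?_ h6
      ext t
      change x t - retInt hT (retMul A (retLam hT (X, U))) t = 0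
      rw [hX, sub_self]
    refine ⟨(ξ, 0) + (X, U), ?_⟩
    change Φ' _ = _
    rw [map_add, e1, e2]
    simp
  have hmap := hΦ.map_nhds_eq_of_surj hsurj
  have hΦ0 : Φ (XB, VB) = 0 := by
    refine Prod.ext ?_ hxT
    ext t
    change xb t - retInt hT _ t = 0
    rw [ret_ftc hT xb _ (fun t ht => ?_) t, hx0]
    · simp
    · have := hxb t ht
      rw [ContinuousMap.comp_apply, hYB]
      exact this
  rw [hΦ0] at hmap
  let ι : E × E → C(Icc (0:ℝ) T, E) × E := fun p => (ContinuousMap.const _ p.1, p.2)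
  have hι : Tendsto ι (𝓝 0) (𝓝 0) := by
    have : Continuous ι := by
      refine Continuous.prodMk ?_ continuous_snd
      exact ContinuousMap.continuous_const'.comp continuous_fst
    exact this.tendsto 0
  have hr : range Φ ∈ 𝓝 (0 : C(Icc (0:ℝ) T, E) × E) := by
    rw [← hmap]; exact range_mem_map
  filter_upwards [hι hr] with p hp
  obtain ⟨⟨x, v⟩, hxv⟩ := hp
  have hx1 : x - retInt hT (ContinuousMap.comp ⟨G, hGc⟩ (retLam hT (x, v)))
    = ContinuousMap.const _ p.1 := congrArg Prod.fst hxv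
  have hx2 : x T1 = p.2 := congrArg Prod.snd hxv
  set R : C(Icc (0:ℝ) T, E) := ContinuousMap.comp ⟨G, hGc⟩ (retLam hT (x, v)) with hR
  have hx3 : ∀ t, x t = p.1 + retInt hT R t := fun t => by
    have := congrArg (fun f => f t) hx1
    simp only [ContinuousMap.sub_apply, ContinuousMap.const_apply] at this
    rw [← this]; abel
  refine ⟨fun t => p.1 + ∫ s in (0:ℝ)..t, retExt hT R s, fun t => ∫ s in (0:ℝ)..t, retExt hT v s,
    retExt hT v, by simp, (retExt_cont hT v).continuousOn, ?_, ?_, by simp, ?_⟩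
  · intro t _
    exact (retExt_cont hT v).integral_hasStrictDerivAt 0 t |>.hasDerivAt
  · intro t ht
    have h := ((retExt_cont hT R).integral_hasStrictDerivAt 0 t).hasDerivAt.const_add p.1
    convert h using 1
    rw [retExt_eq hT R ht, retExt_eq hT v ht, hR, ContinuousMap.comp_apply, retLam_apply, hx3]
    rfl
  · rw [← hx2, hx3]; rfl

end RetAbstract

section RetConcrete

open Set Filter Topology

lemma ret_F_contDiff {m : ℕ} (m₀ : ℝ) (J₀ M J N : Matrix (Fin 3) (Fin 3) ℝ)
    (CM CJ : Matrix (Fin 3) (Fin m) ℝ)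
    (LM RM LJ RJ : Fin m → Matrix (Fin 3) (Fin 3) ℝ)
    (WM WJ : Fin m → Matrix (Fin 3) (Fin m) ℝ) :
    ContDiff ℝ 1 (fun p : (Fin 3 ⊕ Fin 3 → ℝ) × (Fin m → ℝ) =>
      Fstack m₀ J₀ M J N CM CJ LM RM LJ RJ WM WJ p.1 p.2) := by
  have hk : ∀ a, ContDiff ℝ 1 (fun p : (Fin 3 ⊕ Fin 3 → ℝ) × (Fin m → ℝ) => p.1 a) :=
    fun a => by fun_prop
  have hw : ∀ a, ContDiff ℝ 1 (fun p : (Fin 3 ⊕ Fin 3 → ℝ) × (Fin m → ℝ) => p.2 a) :=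
    fun a => by fun_prop
  have hS : ∀ (b : Fin 3 → Fin 3 ⊕ Fin 3) (i j : Fin 3),
      ContDiff ℝ 1 (fun p : (Fin 3 ⊕ Fin 3 → ℝ) × (Fin m → ℝ) => Smat (fun a => p.1 (b a)) i j) := by
    intro b i j
    fin_cases i <;> fin_cases j <;> simp [Smat] <;> fun_prop
  have hmv : ∀ {n : Type} {κ : Type} [Fintype κ]
      (A : (Fin 3 ⊕ Fin 3 → ℝ) × (Fin m → ℝ) → Matrix n κ ℝ)
      (v : (Fin 3 ⊕ Fin 3 → ℝ) × (Fin m → ℝ) → κ → ℝ),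
      (∀ i j, ContDiff ℝ 1 (fun p => A p i j)) → (∀ j, ContDiff ℝ 1 (fun p => v p j)) →
      ∀ i, ContDiff ℝ 1 (fun p => (A p).mulVec (v p) i) := by
    intro n κ _ A v hA hv i
    simp only [Matrix.mulVec, dotProduct]
    exact ContDiff.sum fun j _ => (hA i j).mul (hv j)
  rw [contDiff_pi]
  intro i
  simp only [Fstack, Fquad, Pi.sub_apply, Pi.neg_apply, Finset.sum_apply, Pi.smul_apply,
    smul_eq_mul]
  refine ContDiff.sub (ContDiff.neg (hmv _ _ ?_ ?_ i)) (ContDiff.sum fun p _ => (hw p).mul ?_)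
  · rintro (i | i) (j | j)
    · exact hS Sum.inr i j
    · exact contDiff_const
    · exact hS Sum.inl i j
    · exact hS Sum.inr i j
  · intro j
    refine ContDiff.sub (hmv (fun _ => Jcal m₀ J₀ M J N) _ (fun _ _ => contDiff_const) ?_ j)
      (hmv (fun _ => Cmat CM CJ) _ (fun _ _ => contDiff_const) hw j)
    rintro (j | j)
    · exact hk _
    · exact hk _
  · rcases i with i | i
    · exact ((hmv (fun _ => LM p) _ (fun _ _ => contDiff_const) (fun a => hk (Sum.inl a)) i).add
        (hmv (fun _ => RM p) _ (fun _ _ => contDiff_const) (fun a => hk (Sum.inr a)) i)).add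
        (hmv (fun _ => WM p) _ (fun _ _ => contDiff_const) hw i)
    · exact ((hmv (fun _ => LJ p) _ (fun _ _ => contDiff_const) (fun a => hk (Sum.inl a)) i).add
        (hmv (fun _ => RJ p) _ (fun _ _ => contDiff_const) (fun a => hk (Sum.inr a)) i)).add
        (hmv (fun _ => WJ p) _ (fun _ _ => contDiff_const) hw i)

lemma ret_F_deriv {m : ℕ} (m₀ : ℝ) (J₀ M J N : Matrix (Fin 3) (Fin 3) ℝ)
    (CM CJ : Matrix (Fin 3) (Fin m) ℝ)
    (LM RM LJ RJ : Fin m → Matrix (Fin 3) (Fin 3) ℝ)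
    (WM WJ : Fin m → Matrix (Fin 3) (Fin m) ℝ) (l : Fin 3 → ℝ) (w : Fin m → ℝ)
    (κ : Fin 3 ⊕ Fin 3 → ℝ) (φ : Fin m → ℝ) :
    fderiv ℝ (fun p : (Fin 3 ⊕ Fin 3 → ℝ) × (Fin m → ℝ) =>
      Fstack m₀ J₀ M J N CM CJ LM RM LJ RJ WM WJ p.1 p.2) (Sum.elim l 0, w) (κ, φ)
    = (Amat m₀ J₀ M J N CM CJ LM RM LJ RJ WM WJ l w).mulVec κ
      + (Bmat m₀ J₀ M J N CM CJ LM RM LJ RJ WM WJ l w).mulVec φ := by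
  have hd := ((ret_F_contDiff m₀ J₀ M J N CM CJ LM RM LJ RJ WM WJ).differentiable
    (by norm_num) (Sum.elim l 0, w)).hasFDerivAt
  set D := fderiv ℝ (fun p : (Fin 3 ⊕ Fin 3 → ℝ) × (Fin m → ℝ) =>
      Fstack m₀ J₀ M J N CM CJ LM RM LJ RJ WM WJ p.1 p.2) (Sum.elim l 0, w)
  have hmv : ∀ {n : Type} [Fintype n] [DecidableEq n] (L : (n → ℝ) →L[ℝ] ℝ) (v : n → ℝ),
      ∑ j, L (Pi.single j 1) * v j = L v := by
    intro n _ _ L v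
    conv_rhs => rw [pi_eq_sum_univ' v, map_sum]
    refine Finset.sum_congr rfl fun j _ => ?_
    rw [map_smul, smul_eq_mul, mul_comm]
  ext i
  have p1 : HasFDerivAt (fun e : Fin 3 ⊕ Fin 3 → ℝ => (e, w))
      (ContinuousLinearMap.inl ℝ (Fin 3 ⊕ Fin 3 → ℝ) (Fin m → ℝ))
      (Sum.elim l (0 : Fin 3 → ℝ)) := hasFDerivAt_prodMk_left _ _
  have p2 : HasFDerivAt (fun f : Fin m → ℝ => ((Sum.elim l (0 : Fin 3 → ℝ)), f))
      (ContinuousLinearMap.inr ℝ (Fin 3 ⊕ Fin 3 → ℝ) (Fin m → ℝ)) w :=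
    hasFDerivAt_prodMk_right _ _
  have d1 := HasFDerivAt.comp (Sum.elim l (0 : Fin 3 → ℝ)) (f := fun e => (e, w)) hd p1
  have d2 := HasFDerivAt.comp w (f := fun f => ((Sum.elim l (0 : Fin 3 → ℝ)), f)) hd p2
  have h1 := hasFDerivAt_pi'.1 d1 i
  have h2 := hasFDerivAt_pi'.1 d2 i
  have e1 := h1.fderiv
  have e2 := h2.fderiv
  simp only [Function.comp_def] at e1 e2
  have a1 : (Amat m₀ J₀ M J N CM CJ LM RM LJ RJ WM WJ l w).mulVec κ i = D (κ, 0) i := by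
    simp only [Matrix.mulVec, dotProduct, Amat, Matrix.of_apply]
    rw [hmv, e1]
    rfl
  have a2 : (Bmat m₀ J₀ M J N CM CJ LM RM LJ RJ WM WJ l w).mulVec φ i = D (0, φ) i := by
    simp only [Matrix.mulVec, dotProduct, Bmat, Matrix.of_apply]
    rw [hmv, e2]
    rfl
  rw [Pi.add_apply, a1, a2, ← Pi.add_apply, ← map_add]
  simp

/-- State space. -/
abbrev RetE := (Fin 3 → ℝ) × (Fin 3 → ℝ) × (Fin 3 ⊕ Fin 3 → ℝ)

lemma ret_rhsH_0 (q l : Fin 3 → ℝ) : rhsH q l 0 =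
    (1 - (q 0 ^ 2 + q 1 ^ 2 + q 2 ^ 2)) * l 0
      + 2 * √(1 - (q 0 ^ 2 + q 1 ^ 2 + q 2 ^ 2)) * (q 1 * l 2 - q 2 * l 1)
      + (l 0 * q 0 + l 1 * q 1 + l 2 * q 2) * q 0
      - (q 1 * (l 0 * q 1 - l 1 * q 0) - q 2 * (l 2 * q 0 - l 0 * q 2)) := by
  simp only [rhsH, Pi.sub_apply, Pi.add_apply, Pi.smul_apply, smul_eq_mul, Fin.sum_univ_three]
  simp [cross_apply]

lemma ret_rhsQ_0 (q r : Fin 3 → ℝ) : rhsQ q r 0 =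
    (1 / 2 : ℝ) * (√(1 - (q 0 ^ 2 + q 1 ^ 2 + q 2 ^ 2)) * r 0 + (q 1 * r 2 - q 2 * r 1)) := by
  simp only [rhsQ, Pi.add_apply, Pi.smul_apply, smul_eq_mul, Fin.sum_univ_three]
  simp [cross_apply]

lemma ret_rhsH_1 (q l : Fin 3 → ℝ) : rhsH q l 1 =
    (1 - (q 0 ^ 2 + q 1 ^ 2 + q 2 ^ 2)) * l 1
      + 2 * √(1 - (q 0 ^ 2 + q 1 ^ 2 + q 2 ^ 2)) * (q 2 * l 0 - q 0 * l 2)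
      + (l 0 * q 0 + l 1 * q 1 + l 2 * q 2) * q 1
      - (q 2 * (l 1 * q 2 - l 2 * q 1) - q 0 * (l 0 * q 1 - l 1 * q 0)) := by
  simp only [rhsH, Pi.sub_apply, Pi.add_apply, Pi.smul_apply, smul_eq_mul, Fin.sum_univ_three]
  simp [cross_apply]

lemma ret_rhsQ_1 (q r : Fin 3 → ℝ) : rhsQ q r 1 =
    (1 / 2 : ℝ) * (√(1 - (q 0 ^ 2 + q 1 ^ 2 + q 2 ^ 2)) * r 1 + (q 2 * r 0 - q 0 * r 2)) := by
  simp only [rhsQ, Pi.add_apply, Pi.smul_apply, smul_eq_mul, Fin.sum_univ_three]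
  simp [cross_apply]

lemma ret_rhsH_2 (q l : Fin 3 → ℝ) : rhsH q l 2 =
    (1 - (q 0 ^ 2 + q 1 ^ 2 + q 2 ^ 2)) * l 2
      + 2 * √(1 - (q 0 ^ 2 + q 1 ^ 2 + q 2 ^ 2)) * (q 0 * l 1 - q 1 * l 0)
      + (l 0 * q 0 + l 1 * q 1 + l 2 * q 2) * q 2
      - (q 0 * (l 2 * q 0 - l 0 * q 2) - q 1 * (l 1 * q 2 - l 2 * q 1)) := by
  simp only [rhsH, Pi.sub_apply, Pi.add_apply, Pi.smul_apply, smul_eq_mul, Fin.sum_univ_three]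
  simp [cross_apply]

lemma ret_rhsQ_2 (q r : Fin 3 → ℝ) : rhsQ q r 2 =
    (1 / 2 : ℝ) * (√(1 - (q 0 ^ 2 + q 1 ^ 2 + q 2 ^ 2)) * r 2 + (q 0 * r 1 - q 1 * r 0)) := by
  simp only [rhsQ, Pi.add_apply, Pi.smul_apply, smul_eq_mul, Fin.sum_univ_three]
  simp [cross_apply]

lemma ret_h_cont : Continuous (fun x : RetE => rhsH x.2.1 (fun a => x.2.2 (Sum.inl a))) := by
  refine continuous_pi fun i => ?_
  match i with
  | 0 => simp only [ret_rhsH_0]; fun_prop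
  | 1 => simp only [ret_rhsH_1]; fun_prop
  | 2 => simp only [ret_rhsH_2]; fun_prop

lemma ret_q_cont : Continuous (fun x : RetE => rhsQ x.2.1 (fun a => x.2.2 (Sum.inr a))) := by
  refine continuous_pi fun i => ?_
  match i with
  | 0 => simp only [ret_rhsQ_0]; fun_prop
  | 1 => simp only [ret_rhsQ_1]; fun_prop
  | 2 => simp only [ret_rhsQ_2]; fun_prop

lemma ret_sqrt (x : RetE) (hx : x.2.1 = 0) : ContDiffAt ℝ 1
    (fun x : RetE => √(1 - (x.2.1 0 ^ 2 + x.2.1 1 ^ 2 + x.2.1 2 ^ 2))) x := by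
  refine ContDiffAt.sqrt (by fun_prop) ?_
  simp [hx]

lemma ret_h_cd (x : RetE) (hx : x.2.1 = 0) :
    ContDiffAt ℝ 1 (fun x : RetE => rhsH x.2.1 (fun a => x.2.2 (Sum.inl a))) x := by
  have := ret_sqrt x hx
  rw [contDiffAt_pi]
  intro i
  match i with
  | 0 => simp only [ret_rhsH_0]; fun_prop
  | 1 => simp only [ret_rhsH_1]; fun_prop
  | 2 => simp only [ret_rhsH_2]; fun_prop

lemma ret_q_cd (x : RetE) (hx : x.2.1 = 0) :
    ContDiffAt ℝ 1 (fun x : RetE => rhsQ x.2.1 (fun a => x.2.2 (Sum.inr a))) x := by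
  have := ret_sqrt x hx
  rw [contDiffAt_pi]
  intro i
  match i with
  | 0 => simp only [ret_rhsQ_0]; fun_prop
  | 1 => simp only [ret_rhsQ_1]; fun_prop
  | 2 => simp only [ret_rhsQ_2]; fun_prop

lemma ret_sqrt_deriv (q : Fin 3 → ℝ) :
    HasDerivAt (fun s : ℝ => √(1 - ((s * q 0) ^ 2 + (s * q 1) ^ 2 + (s * q 2) ^ 2))) 0 0 := by
  have h0 : HasDerivAt (fun s : ℝ => 1 - ((s * q 0) ^ 2 + (s * q 1) ^ 2 + (s * q 2) ^ 2)) 0 0 := by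
    have e : (fun s : ℝ => 1 - ((s * q 0) ^ 2 + (s * q 1) ^ 2 + (s * q 2) ^ 2))
      = fun s : ℝ => 1 - s ^ 2 * (q 0 ^ 2 + q 1 ^ 2 + q 2 ^ 2) := by ext s; ring
    rw [e]
    have := (((hasDerivAt_id (0:ℝ)).pow 2).mul_const (q 0 ^ 2 + q 1 ^ 2 + q 2 ^ 2)).const_sub 1
    simpa using this
  have := h0.sqrt (by simp)
  simpa using this

/-- directional derivative computation -/
lemma ret_dir {P F : Type*} [NormedAddCommGroup P] [NormedSpace ℝ P]
    [NormedAddCommGroup F] [NormedSpace ℝ F] (G : P → F) (y d : P) (h : DifferentiableAt ℝ G y) :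
    HasDerivAt (fun s : ℝ => G (y + s • d)) (fderiv ℝ G y d) 0 := by
  have h1 : HasDerivAt (fun s : ℝ => y + s • d) d 0 := by
    simpa using ((hasDerivAt_id (0:ℝ)).smul_const d).const_add y
  have h2 : HasFDerivAt G (fderiv ℝ G y) (y + (0:ℝ) • d) := by simpa using h.hasFDerivAt
  exact h2.comp_hasDerivAt 0 h1

lemma ret_h_deriv (x d : RetE) (hx : x.2.1 = 0) (i : Fin 3) :
    fderiv ℝ (fun x : RetE => rhsH x.2.1 (fun a => x.2.2 (Sum.inl a))) x d i
      = d.2.2 (Sum.inl i) +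
        (2:ℝ) * crossProduct d.2.1 (fun a => x.2.2 (Sum.inl a)) i := by
  have h := hasDerivAt_pi.1 (ret_dir _ x d ((ret_h_cd x hx).differentiableAt (by norm_num))) i
  refine h.unique ?_
  have hs := ret_sqrt_deriv d.2.1
  have hl : ∀ a, HasDerivAt (fun s : ℝ => x.2.2 a + s * d.2.2 a) (d.2.2 a) 0 := fun a => by
    simpa using ((hasDerivAt_id (0:ℝ)).mul_const (d.2.2 a)).const_add (x.2.2 a)
  have hq : ∀ a, HasDerivAt (fun s : ℝ => s * d.2.1 a) (d.2.1 a) 0 := fun a => by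
    simpa using ((hasDerivAt_id (0:ℝ)).mul_const (d.2.1 a))
  have hn : HasDerivAt (fun s : ℝ => 1 - ((s * d.2.1 0) ^ 2 + (s * d.2.1 1) ^ 2
      + (s * d.2.1 2) ^ 2)) 0 0 := by
    have := ((((hq 0).pow 2).add ((hq 1).pow 2)).add ((hq 2).pow 2)).const_sub 1
    simpa using this
  have hdot := ((((hl (.inl 0)).mul (hq 0)).add ((hl (.inl 1)).mul (hq 1))).add
    ((hl (.inl 2)).mul (hq 2)))
  have key : ∀ i j k : Fin 3, HasDerivAt (fun s : ℝ =>
      (1 - ((s * d.2.1 0) ^ 2 + (s * d.2.1 1) ^ 2 + (s * d.2.1 2) ^ 2))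
        * (x.2.2 (.inl i) + s * d.2.2 (.inl i))
      + 2 * √(1 - ((s * d.2.1 0) ^ 2 + (s * d.2.1 1) ^ 2 + (s * d.2.1 2) ^ 2))
        * ((s * d.2.1 j) * (x.2.2 (.inl k) + s * d.2.2 (.inl k))
          - (s * d.2.1 k) * (x.2.2 (.inl j) + s * d.2.2 (.inl j)))
      + ((x.2.2 (.inl 0) + s * d.2.2 (.inl 0)) * (s * d.2.1 0)
        + (x.2.2 (.inl 1) + s * d.2.2 (.inl 1)) * (s * d.2.1 1)
        + (x.2.2 (.inl 2) + s * d.2.2 (.inl 2)) * (s * d.2.1 2)) * (s * d.2.1 i)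
      - ((s * d.2.1 j) * ((x.2.2 (.inl i) + s * d.2.2 (.inl i)) * (s * d.2.1 j)
          - (x.2.2 (.inl j) + s * d.2.2 (.inl j)) * (s * d.2.1 i))
        - (s * d.2.1 k) * ((x.2.2 (.inl k) + s * d.2.2 (.inl k)) * (s * d.2.1 i)
          - (x.2.2 (.inl i) + s * d.2.2 (.inl i)) * (s * d.2.1 k))))
      (d.2.2 (.inl i) + 2 * (d.2.1 j * x.2.2 (.inl k) - d.2.1 k * x.2.2 (.inl j))) 0 := by
    intro i j k
    have := (((hn.mul (hl (.inl i))).add ((hs.const_mul 2).mul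
      (((hq j).mul (hl (.inl k))).sub ((hq k).mul (hl (.inl j)))))).add (hdot.mul (hq i))).sub
      (((hq j).mul (((hl (.inl i)).mul (hq j)).sub ((hl (.inl j)).mul (hq i)))).sub
        ((hq k).mul (((hl (.inl k)).mul (hq i)).sub ((hl (.inl i)).mul (hq k)))))
    refine this.congr_deriv ?_
    simp
  match i with
  | 0 =>
    refine ((key 0 1 2).congr_deriv (by simp [cross_apply])).congr_of_eventuallyEq
      (.of_forall fun s => ?_)
    simp [ret_rhsH_0, hx]
  | 1 =>
    refine ((key 1 2 0).congr_deriv (by simp [cross_apply])).congr_of_eventuallyEq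
      (.of_forall fun s => ?_)
    simp [ret_rhsH_1, hx]
  | 2 =>
    refine ((key 2 0 1).congr_deriv (by simp [cross_apply])).congr_of_eventuallyEq
      (.of_forall fun s => ?_)
    simp [ret_rhsH_2, hx]

lemma ret_q_deriv (x d : RetE) (hx : x.2.1 = 0) (hr : ∀ a, x.2.2 (Sum.inr a) = 0) (i : Fin 3) :
    fderiv ℝ (fun x : RetE => rhsQ x.2.1 (fun a => x.2.2 (Sum.inr a))) x d i
      = (1/2 : ℝ) * d.2.2 (Sum.inr i) := by
  have h := hasDerivAt_pi.1 (ret_dir _ x d ((ret_q_cd x hx).differentiableAt (by norm_num))) i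
  refine h.unique ?_
  have hs := ret_sqrt_deriv d.2.1
  have hl : ∀ a, HasDerivAt (fun s : ℝ => s * d.2.2 a) (d.2.2 a) 0 := fun a => by
    simpa using ((hasDerivAt_id (0:ℝ)).mul_const (d.2.2 a))
  have hq : ∀ a, HasDerivAt (fun s : ℝ => s * d.2.1 a) (d.2.1 a) 0 := fun a => by
    simpa using ((hasDerivAt_id (0:ℝ)).mul_const (d.2.1 a))
  have key : ∀ i j k : Fin 3, HasDerivAt (fun s : ℝ => (1/2:ℝ) *
      (√(1 - ((s * d.2.1 0) ^ 2 + (s * d.2.1 1) ^ 2 + (s * d.2.1 2) ^ 2)) * (s * d.2.2 (.inr i))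
        + ((s * d.2.1 j) * (s * d.2.2 (.inr k)) - (s * d.2.1 k) * (s * d.2.2 (.inr j)))))
      ((1/2:ℝ) * d.2.2 (.inr i)) 0 := by
    intro i j k
    have := ((hs.mul (hl (.inr i))).add (((hq j).mul (hl (.inr k))).sub
      ((hq k).mul (hl (.inr j))))).const_mul (1/2:ℝ)
    refine this.congr_deriv ?_
    simp
  match i with
  | 0 =>
    refine (key 0 1 2).congr_of_eventuallyEq (.of_forall fun s => ?_)
    simp [ret_rhsQ_0, hx, hr]
  | 1 =>
    refine (key 1 2 0).congr_of_eventuallyEq (.of_forall fun s => ?_)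
    simp [ret_rhsQ_1, hx, hr]
  | 2 =>
    refine (key 2 0 1).congr_of_eventuallyEq (.of_forall fun s => ?_)
    simp [ret_rhsQ_2, hx, hr]

end RetConcrete

/-- Theorem 3.3 of the paper, return method.
Given a smooth reference loop `(h̄, 0, l̄, 0, w̄)` of the nonlinear system with
`h̄(0)=h̄(T)=0`, `l̄(0)=l̄(T)=0`, `w̄(0)=0`, if the linearized system along this
trajectory is controllable on `[0,T]` with `C¹` controls vanishing at `0`,
then the nonlinear system is locally controllable around the origin in
time `T`. -/
theorem stmt_2 (m : ℕ) (hm : 0 < m) (T : ℝ) (hT : 0 < T)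
    (m₀ : ℝ) (hm₀ : 0 < m₀) (J₀ M J N : Matrix (Fin 3) (Fin 3) ℝ)
    (CM CJ : Matrix (Fin 3) (Fin m) ℝ)
    (LM RM LJ RJ : Fin m → Matrix (Fin 3) (Fin 3) ℝ)
    (WM WJ : Fin m → Matrix (Fin 3) (Fin m) ℝ)
    (hinv : IsUnit (Jcal m₀ J₀ M J N))
    -- the reference trajectory (h̄, 0, l̄, 0, w̄), of class C^∞ on [0,T]
    (hbar lbar : ℝ → Fin 3 → ℝ) (wbar wbar' : ℝ → Fin m → ℝ)
    (hsmooth_h : ContDiffOn ℝ (⊤ : ℕ∞) hbar (Set.Icc 0 T))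
    (hsmooth_l : ContDiffOn ℝ (⊤ : ℕ∞) lbar (Set.Icc 0 T))
    (hsmooth_w : ContDiffOn ℝ (⊤ : ℕ∞) wbar (Set.Icc 0 T))
    -- it solves the nonlinear system (with q⃗ ≡ 0 and r ≡ 0)
    (hbar_dyn : ∀ t ∈ Set.Icc (0:ℝ) T, ∀ i : Fin 3,
      HasDerivAt (fun s => hbar s i) (rhsH (0 : Fin 3 → ℝ) (lbar t) i) t)
    (qbar_dyn : ∀ t ∈ Set.Icc (0:ℝ) T, ∀ i : Fin 3,
      HasDerivAt (fun _ : ℝ => (0 : ℝ)) (rhsQ (0 : Fin 3 → ℝ) (0 : Fin 3 → ℝ) i) t)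
    (wbar_dyn : ∀ t ∈ Set.Icc (0:ℝ) T, ∀ j : Fin m,
      HasDerivAt (fun s => wbar s j) (wbar' t j) t)
    (lrbar_dyn : ∀ t ∈ Set.Icc (0:ℝ) T, ∀ i : Fin 3 ⊕ Fin 3,
      HasDerivAt (fun s => Sum.elim (lbar s) (0 : Fin 3 → ℝ) i)
        (((Jcal m₀ J₀ M J N)⁻¹).mulVec
          ((Cmat CM CJ).mulVec (wbar' t)
            + Fquad m₀ J₀ M J N CM CJ LM RM LJ RJ WM WJ
                (lbar t) (0 : Fin 3 → ℝ) (wbar t)) i) t)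
    -- loop conditions
    (hbar0 : hbar 0 = 0) (hbarT : hbar T = 0)
    (lbar0 : lbar 0 = 0) (lbarT : lbar T = 0) (wbar0 : wbar 0 = 0)
    -- controllability of the linearized system along the reference trajectory
    (hlin : ∀ z₀ z₁ : (Fin 3 → ℝ) × (Fin 3 → ℝ) × (Fin 3 ⊕ Fin 3 → ℝ),
      ∃ (f f' : ℝ → Fin m → ℝ) (hh qh : ℝ → Fin 3 → ℝ) (kh : ℝ → Fin 3 ⊕ Fin 3 → ℝ),
        f 0 = 0 ∧ ContinuousOn f' (Set.Icc 0 T) ∧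
        (∀ t ∈ Set.Icc (0:ℝ) T, ∀ j : Fin m,
          HasDerivAt (fun s => f s j) (f' t j) t) ∧
        (∀ t ∈ Set.Icc (0:ℝ) T, ∀ i : Fin 3,
          HasDerivAt (fun s => hh s i)
            (kh t (Sum.inl i) + (2:ℝ) * crossProduct (qh t) (lbar t) i) t) ∧
        (∀ t ∈ Set.Icc (0:ℝ) T, ∀ i : Fin 3,
          HasDerivAt (fun s => qh s i) ((1/2 : ℝ) * kh t (Sum.inr i)) t) ∧
        (∀ t ∈ Set.Icc (0:ℝ) T, ∀ i : Fin 3 ⊕ Fin 3,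
          HasDerivAt (fun s => kh s i)
            (((Jcal m₀ J₀ M J N)⁻¹).mulVec
              ((Amat m₀ J₀ M J N CM CJ LM RM LJ RJ WM WJ (lbar t) (wbar t)).mulVec (kh t)
                + (Bmat m₀ J₀ M J N CM CJ LM RM LJ RJ WM WJ (lbar t) (wbar t)).mulVec (f t)
                + (Cmat CM CJ).mulVec (f' t)) i) t) ∧
        (hh 0, qh 0, kh 0) = z₀ ∧ (hh T, qh T, kh T) = z₁) :
    -- conclusion : local controllability of the nonlinear system around 0
    ∃ η > (0:ℝ), ∀ h₀ q₀ l₀ r₀ hT' qT lT rT : Fin 3 → ℝ,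
      ‖h₀‖ < η → ‖q₀‖ < η → ‖l₀‖ < η → ‖r₀‖ < η →
      ‖hT'‖ < η → ‖qT‖ < η → ‖lT‖ < η → ‖rT‖ < η →
      ∃ (w w' : ℝ → Fin m → ℝ) (h q l r : ℝ → Fin 3 → ℝ),
        w 0 = 0 ∧ ContinuousOn w' (Set.Icc 0 T) ∧
        (∀ t ∈ Set.Icc (0:ℝ) T, ∀ j : Fin m,
          HasDerivAt (fun s => w s j) (w' t j) t) ∧
        (∀ t ∈ Set.Icc (0:ℝ) T, ∀ i : Fin 3,
          HasDerivAt (fun s => h s i) (rhsH (q t) (l t) i) t) ∧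
        (∀ t ∈ Set.Icc (0:ℝ) T, ∀ i : Fin 3,
          HasDerivAt (fun s => q s i) (rhsQ (q t) (r t) i) t) ∧
        (∀ t ∈ Set.Icc (0:ℝ) T, ∀ i : Fin 3 ⊕ Fin 3,
          HasDerivAt (fun s => Sum.elim (l s) (r s) i)
            (((Jcal m₀ J₀ M J N)⁻¹).mulVec
              ((Cmat CM CJ).mulVec (w' t)
                + Fquad m₀ J₀ M J N CM CJ LM RM LJ RJ WM WJ (l t) (r t) (w t)) i) t) ∧
        h 0 = h₀ ∧ q 0 = q₀ ∧ l 0 = l₀ ∧ r 0 = r₀ ∧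
        h T = hT' ∧ q T = qT ∧ l T = lT ∧ r T = rT := by
  classical
  let Ji : (Fin 3 ⊕ Fin 3 → ℝ) →L[ℝ] (Fin 3 ⊕ Fin 3 → ℝ) :=
    LinearMap.toContinuousLinearMap (Matrix.mulVecLin (Jcal m₀ J₀ M J N)⁻¹)
  let Cc : (Fin m → ℝ) →L[ℝ] (Fin 3 ⊕ Fin 3 → ℝ) :=
    LinearMap.toContinuousLinearMap (Matrix.mulVecLin (Cmat CM CJ))
  have hJi : ∀ v, Ji v = ((Jcal m₀ J₀ M J N)⁻¹).mulVec v := fun v => rfl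
  have hCc : ∀ v, Cc v = (Cmat CM CJ).mulVec v := fun v => rfl
  let G1 : RetE → Fin 3 → ℝ := fun x => rhsH x.2.1 (fun a => x.2.2 (Sum.inl a))
  let G2 : RetE → Fin 3 → ℝ := fun x => rhsQ x.2.1 (fun a => x.2.2 (Sum.inr a))
  let G3 : (Fin 3 ⊕ Fin 3 → ℝ) × (Fin m → ℝ) → Fin 3 ⊕ Fin 3 → ℝ := fun p =>
    Fstack m₀ J₀ M J N CM CJ LM RM LJ RJ WM WJ p.1 p.2
  let G : RetE × (Fin m → ℝ) × (Fin m → ℝ) → RetE := fun z =>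
    (G1 z.1, G2 z.1, Ji (Cc z.2.2 + G3 (z.1.2.2, z.2.1)))
  have hG3 : ContDiff ℝ 1 G3 := ret_F_contDiff m₀ J₀ M J N CM CJ LM RM LJ RJ WM WJ
  have hGc : Continuous G := by
    have h1 : Continuous G1 := ret_h_cont
    have h2 : Continuous G2 := ret_q_cont
    have h3 : Continuous G3 := hG3.continuous
    exact (h1.comp continuous_fst).prodMk ((h2.comp continuous_fst).prodMk
      (Ji.continuous.comp ((Cc.continuous.comp (by fun_prop)).add (h3.comp (by fun_prop)))))
  let xb : ℝ → RetE := fun t => (hbar t, 0, Sum.elim (lbar t) (0 : Fin 3 → ℝ))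
  have hGd : ∀ t, ContDiffAt ℝ 1 G (xb t, wbar t, wbar' t) := by
    intro t
    have h1 : ContDiffAt ℝ 1 G1 (xb t) := ret_h_cd (xb t) rfl
    have h2 : ContDiffAt ℝ 1 G2 (xb t) := ret_q_cd (xb t) rfl
    have h1' : ContDiffAt ℝ 1 (fun z : RetE × (Fin m → ℝ) × (Fin m → ℝ) => G1 z.1)
        (xb t, wbar t, wbar' t) :=
      ContDiffAt.comp (g := G1) (f := Prod.fst) _ h1 contDiffAt_fst
    have h2' : ContDiffAt ℝ 1 (fun z : RetE × (Fin m → ℝ) × (Fin m → ℝ) => G2 z.1)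
        (xb t, wbar t, wbar' t) :=
      ContDiffAt.comp (g := G2) (f := Prod.fst) _ h2 contDiffAt_fst
    refine ContDiffAt.prodMk h1' (ContDiffAt.prodMk h2' ?_)
    refine ContDiff.contDiffAt (Ji.contDiff.comp (ContDiff.add (Cc.contDiff.comp ?_)
      (hG3.comp ?_)))
    · fun_prop
    · fun_prop
  -- the derivative of `G` along the reference trajectory
  have hGf : ∀ t (d : RetE) (f f' : Fin m → ℝ),
      fderiv ℝ G (xb t, wbar t, wbar' t) (d, f, f') =
        ((fun i => d.2.2 (Sum.inl i) + (2:ℝ) * crossProduct d.2.1 (lbar t) i),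
         (fun i => (1/2 : ℝ) * d.2.2 (Sum.inr i)),
         ((Jcal m₀ J₀ M J N)⁻¹).mulVec
              ((Amat m₀ J₀ M J N CM CJ LM RM LJ RJ WM WJ (lbar t) (wbar t)).mulVec d.2.2
                + (Bmat m₀ J₀ M J N CM CJ LM RM LJ RJ WM WJ (lbar t) (wbar t)).mulVec f
                + (Cmat CM CJ).mulVec f')) := by
    intro t d f f'
    have h1 : HasFDerivAt G1 (fderiv ℝ G1 (xb t)) (xb t) :=
      ((ret_h_cd (xb t) rfl).differentiableAt (by norm_num)).hasFDerivAt
    have h2 : HasFDerivAt G2 (fderiv ℝ G2 (xb t)) (xb t) :=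
      ((ret_q_cd (xb t) rfl).differentiableAt (by norm_num)).hasFDerivAt
    have h3 : HasFDerivAt G3 (fderiv ℝ G3 (Sum.elim (lbar t) 0, wbar t))
        (Sum.elim (lbar t) 0, wbar t) := (hG3.differentiable (by norm_num) _).hasFDerivAt
    let π1 : RetE × (Fin m → ℝ) × (Fin m → ℝ) →L[ℝ] RetE := ContinuousLinearMap.fst ℝ _ _
    let π3 : RetE × (Fin m → ℝ) × (Fin m → ℝ) →L[ℝ] (Fin m → ℝ) :=
      (ContinuousLinearMap.snd ℝ _ _).comp (ContinuousLinearMap.snd ℝ _ _)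
    let π2 : RetE × (Fin m → ℝ) × (Fin m → ℝ) →L[ℝ] (Fin 3 ⊕ Fin 3 → ℝ) × (Fin m → ℝ) :=
      (((ContinuousLinearMap.snd ℝ _ _).comp (ContinuousLinearMap.snd ℝ _ _)).comp π1).prod
        ((ContinuousLinearMap.fst ℝ _ _).comp (ContinuousLinearMap.snd ℝ _ _))
    have e1 := HasFDerivAt.comp (xb t, wbar t, wbar' t) h1 π1.hasFDerivAt
    have e2 := HasFDerivAt.comp (xb t, wbar t, wbar' t) h2 π1.hasFDerivAt
    have e3 := HasFDerivAt.comp (xb t, wbar t, wbar' t) h3 π2.hasFDerivAt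
    have e4 := HasFDerivAt.comp (xb t, wbar t, wbar' t) Ji.hasFDerivAt
      (((Cc.comp π3).hasFDerivAt).add e3)
    have e5 : HasFDerivAt G _ (xb t, wbar t, wbar' t) := e1.prodMk (e2.prodMk e4)
    rw [e5.fderiv]
    refine Prod.ext ?_ (Prod.ext ?_ ?_)
    · funext i
      exact ret_h_deriv (xb t) d rfl i
    · funext i
      exact ret_q_deriv (xb t) d rfl (fun _ => rfl) i
    · change Ji (Cc f' + fderiv ℝ G3 (Sum.elim (lbar t) 0, wbar t) (d.2.2, f)) = _
      rw [ret_F_deriv, hJi, hCc, add_comm]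
  have hvb : ContinuousOn wbar' (Set.Icc 0 T) := by
    have hc := hsmooth_w.continuousOn_derivWithin (uniqueDiffOn_Icc hT) (by simp)
    refine hc.congr fun t ht => ?_
    exact ((hasDerivAt_pi.2 (wbar_dyn t ht)).hasDerivWithinAt.derivWithin
      (uniqueDiffOn_Icc hT t ht)).symm
  have main := ret_main hT G hGc xb wbar wbar' hvb (fun t _ => hGd t)
    (by
      intro t ht
      refine (hasDerivAt_pi.2 (hbar_dyn t ht)).prodMk (HasDerivAt.prodMk ?_
        (hasDerivAt_pi.2 (lrbar_dyn t ht)))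
      exact hasDerivAt_pi.2 (qbar_dyn t ht))
    (fun t ht => hasDerivAt_pi.2 (wbar_dyn t ht))
    (by
      refine Prod.ext hbar0 (Prod.ext rfl ?_)
      simp only [xb, lbar0]
      ext (i | i) <;> rfl)
    (by
      refine Prod.ext hbarT (Prod.ext rfl ?_)
      simp only [xb, lbarT]
      ext (i | i) <;> rfl)
    wbar0
    (by
      intro b
      obtain ⟨f, f', hh, qh, kh, a1, a2, a3, a4, a5, a6, a7, a8⟩ := hlin 0 b
      refine ⟨fun t => (hh t, qh t, kh t), f, f', a1, a2, fun t ht => hasDerivAt_pi.2 (a3 t ht),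
        fun t ht => ?_, a7, a8⟩
      rw [hGf]
      exact (hasDerivAt_pi.2 (a4 t ht)).prodMk ((hasDerivAt_pi.2 (a5 t ht)).prodMk
        (hasDerivAt_pi.2 (a6 t ht))))
  rw [Metric.eventually_nhds_iff] at main
  obtain ⟨η, hη, main⟩ := main
  refine ⟨η, hη, fun h₀ q₀ l₀ r₀ hT' qT lT rT b1 b2 b3 b4 b5 b6 b7 b8 => ?_⟩
  have hel : ∀ l r : Fin 3 → ℝ, ‖l‖ < η → ‖r‖ < η → ‖Sum.elim l r‖ < η := by
    intro l r hl hr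
    rw [pi_norm_lt_iff hη] at hl hr ⊢
    rintro (i | i)
    · exact hl i
    · exact hr i
  obtain ⟨x, w, v, c1, c2, c3, c4, c5, c6⟩ :=
    @main ((h₀, q₀, Sum.elim l₀ r₀), (hT', qT, Sum.elim lT rT)) (by
      rw [dist_zero_right]
      exact max_lt (max_lt b1 (max_lt b2 (hel _ _ b3 b4)))
        (max_lt b5 (max_lt b6 (hel _ _ b7 b8))))
  have hse : ∀ k : Fin 3 ⊕ Fin 3 → ℝ, Sum.elim (fun a => k (Sum.inl a)) (fun a => k (Sum.inr a))
      = k := by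
    intro k; ext (i | i) <;> rfl
  have hx2 : ∀ t ∈ Set.Icc 0 T, HasDerivAt (fun s => (x s).2) (G (x t, w t, v t)).2 t :=
    fun t ht => (hasFDerivAt_snd (𝕜 := ℝ) (p := x t)).comp_hasDerivAt t (c4 t ht)
  have hx21 : ∀ t ∈ Set.Icc 0 T, HasDerivAt (fun s => (x s).2.1) (G (x t, w t, v t)).2.1 t :=
    fun t ht => (hasFDerivAt_fst (𝕜 := ℝ) (p := (x t).2)).comp_hasDerivAt t
      (f := fun s => (x s).2) (hx2 t ht)
  have hx22 : ∀ t ∈ Set.Icc 0 T, HasDerivAt (fun s => (x s).2.2) (G (x t, w t, v t)).2.2 t :=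
    fun t ht => (hasFDerivAt_snd (𝕜 := ℝ) (p := (x t).2)).comp_hasDerivAt t
      (f := fun s => (x s).2) (hx2 t ht)
  refine ⟨w, v, fun t => (x t).1, fun t => (x t).2.1, fun t a => (x t).2.2 (Sum.inl a),
    fun t a => (x t).2.2 (Sum.inr a), c1, c2, fun t ht => hasDerivAt_pi.1 (c3 t ht), ?_, ?_, ?_,
    ?_, ?_, ?_, ?_, ?_, ?_, ?_, ?_⟩
  · intro t ht
    exact hasDerivAt_pi.1 ((hasFDerivAt_fst (𝕜 := ℝ) (p := x t)).comp_hasDerivAt t (c4 t ht))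
  · intro t ht
    exact hasDerivAt_pi.1 (hx21 t ht)
  · intro t ht i
    simp only [hse]
    exact hasDerivAt_pi.1 (hx22 t ht) i
  all_goals simp only [c5, c6, Sum.elim_inl, Sum.elim_inr]

end
end

section
/- Let n, m ≥ 1, T > 0, ε > 0, and let 𝒜 : (−ε, T+ε) → ℝ^{n×n} and ℬ : (−ε, T+ε) → ℝ^{n×m} be real-analytic, and 𝒞 ∈ ℝ^{n×m}. Define matrices ℳ_i(t) ∈ ℝ^{n×m} by ℳ₀(t) = ℬ(t) + 𝒜(t)𝒞 and ℳ_i(t) = ℳ_{i−1}'(t) − 𝒜(t)ℳ_{i−1}(t) for i ≥ 1, and let φ(t,s) be the fundamental solution of ẋ = 𝒜(t)x (i.e., ∂φ/∂t = 𝒜(t)φ(t,s), φ(s,s) = Id). Define the reachable set R = { x(T) : u ∈ C¹([0,T]; ℝ^m), u(0) = 0, and x : [0,T] → ℝⁿ solves ẋ = 𝒜(t)x + ℬ(t)u + 𝒞 u̇ with x(0) = 0 }. Then for every t₀ ∈ [0,T], R = 𝒞 ℝ^m + Span{ φ(T, t₀) ℳ_i(t₀) u : u ∈ ℝ^m, i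 ≥ 0 }. -/
open Filter Topology

noncomputable def psol {𝔸 : Type*} [NormedRing 𝔸] [NormedAlgebra ℝ 𝔸] (a : ℕ → 𝔸) : ℕ → 𝔸
  | 0 => 1
  | k+1 => ((k+1:ℝ))⁻¹ • ∑ i : Fin (k+1), a i * psol a (k - i)
  decreasing_by omega

theorem psol_succ {𝔸 : Type*} [NormedRing 𝔸] [NormedAlgebra ℝ 𝔸] (a : ℕ → 𝔸) (k : ℕ) :
    ((k:ℝ)+1) • psol a (k+1) = ∑ i ∈ Finset.range (k+1), a i * psol a (k - i) := by
  rw [psol, smul_smul, mul_inv_cancel₀ (by positivity), one_smul, Finset.sum_range]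

theorem psol_bound {𝔸 : Type*} [NormedRing 𝔸] [NormedAlgebra ℝ 𝔸] (a : ℕ → 𝔸) (K ρ R : ℝ)
    (hρ : 0 ≤ ρ) (hK : 0 ≤ K) (ha : ∀ k, ‖a k‖ ≤ K * ρ ^ k) (h1 : K ≤ R) (h2 : ρ ≤ R) (k : ℕ) :
    ‖psol a k‖ ≤ ‖(1:𝔸)‖ * R ^ k := by
  induction k using Nat.strong_induction_on with
  | _ k ih =>
    rcases k with _ | k
    · simp [psol]
    have hR : 0 ≤ R := hK.trans h1
    rw [psol, norm_smul, norm_inv, ← Finset.sum_range (f := fun i => a i * psol a (k - i))]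
    have hb : ‖∑ i ∈ Finset.range (k+1), a i * psol a (k - i)‖ ≤
        ∑ i ∈ Finset.range (k+1), K * (‖(1:𝔸)‖ * R ^ k) := by
      refine norm_sum_le_of_le _ fun i hi => ?_
      have hik : i ≤ k := by simpa [Nat.lt_succ_iff] using hi
      calc ‖a i * psol a (k - i)‖ ≤ ‖a i‖ * ‖psol a (k - i)‖ := norm_mul_le _ _
        _ ≤ (K * R ^ i) * (‖(1:𝔸)‖ * R ^ (k - i)) := by
            gcongr
            · exact (ha i).trans (by gcongr)
            · exact ih _ (by omega)
        _ = K * (‖(1:𝔸)‖ * (R ^ i * R ^ (k - i))) := by ring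
        _ = _ := by rw [← pow_add, Nat.add_sub_cancel' hik]
    have hn : ‖((k:ℝ)+1)‖ = (k:ℝ)+1 := by rw [Real.norm_of_nonneg]; positivity
    rw [hn]
    calc ((k:ℝ)+1)⁻¹ * ‖∑ i ∈ Finset.range (k+1), a i * psol a (k - i)‖ 
        ≤ ((k:ℝ)+1)⁻¹ * ∑ i ∈ Finset.range (k+1), K * (‖(1:𝔸)‖ * R ^ k) := by gcongr
      _ = K * (‖(1:𝔸)‖ * R ^ k) := by
          rw [Finset.sum_const, Finset.card_range, nsmul_eq_mul]
          push_cast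
          rw [← mul_assoc, inv_mul_cancel₀ (by positivity), one_mul]
      _ ≤ R * (‖(1:𝔸)‖ * R ^ k) := by gcongr
      _ = _ := by ring

theorem analytic_ode {𝔸 : Type*} [NormedRing 𝔸] [NormedAlgebra ℝ 𝔸] [CompleteSpace 𝔸]
    (A : ℝ → 𝔸) (s : ℝ) (hA : AnalyticAt ℝ A s) :
    ∃ Y : ℝ → 𝔸, AnalyticAt ℝ Y s ∧ Y s = 1 ∧ ∀ᶠ t in 𝓝 s, HasDerivAt Y (A t * Y t) t := by
  obtain ⟨p, r, hp⟩ := hA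
  obtain ⟨K, ρ, hK, hρ, hb⟩ := p.le_mul_pow_of_radius_pos (hp.r_pos.trans_le hp.r_le)
  have ha : ∀ k, ‖p.coeff k‖ ≤ K * ρ ^ k := fun k => by
    rw [← FormalMultilinearSeries.norm_apply_eq_norm_coef]; exact hb k
  set c := psol p.coeff with hc
  set R : ℝ := max K ρ with hR
  have hR0 : 0 < R := lt_max_of_lt_left hK
  have hcb : ∀ k, ‖c k‖ ≤ ‖(1:𝔸)‖ * R ^ k :=
    psol_bound p.coeff K ρ R hρ.le hK.le ha (le_max_left _ _) (le_max_right _ _)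
  let q : FormalMultilinearSeries ℝ ℝ 𝔸 := fun k => ContinuousMultilinearMap.mkPiRing ℝ (Fin k) (c k)
  have hqc : ∀ k, q.coeff k = c k := fun k => by
    simp [q, FormalMultilinearSeries.coeff]
  have hqr : 0 < q.radius := by
    have := q.le_radius_of_bound ‖(1:𝔸)‖ (r := Real.toNNReal R⁻¹) (fun k => by
      rw [Real.coe_toNNReal _ (by positivity), FormalMultilinearSeries.norm_apply_eq_norm_coef, hqc]
      calc ‖c k‖ * (R⁻¹) ^ k ≤ (‖(1:𝔸)‖ * R ^ k) * (R⁻¹) ^ k := by gcongr; exact hcb k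
        _ = _ := by rw [mul_assoc, ← mul_pow, mul_inv_cancel₀ hR0.ne', one_pow, mul_one])
    refine lt_of_lt_of_le ?_ this
    rw [ENNReal.coe_pos, Real.toNNReal_pos]
    positivity
  have hG := q.hasFPowerSeriesOnBall hqr
  have hG' := hG.fderiv
  have key : ∀ h ∈ Metric.eball (0:ℝ) (min r q.radius),
      HasDerivAt q.sum (A (s + h) * q.sum h) h := by
    intro h hh
    have hhr : h ∈ Metric.eball (0:ℝ) r := Metric.eball_subset_eball (min_le_left _ _) hh
    have hhq : h ∈ Metric.eball (0:ℝ) q.radius := Metric.eball_subset_eball (min_le_right _ _) hh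
    have s1 := hp.hasSum hhr
    have s2 := hG.hasSum hhq
    have s3 := (hG'.hasSum hhq).mapL (ContinuousLinearMap.apply ℝ 𝔸 (1:ℝ))
    have hd : DifferentiableAt ℝ q.sum h := 
      (hG.analyticAt_of_mem (by simpa using hhq)).differentiableAt
    have n1 := p.summable_norm_apply (Metric.eball_subset_eball hp.r_le hhr)
    have n2 := q.summable_norm_apply hhq
    have s4 := hasSum_sum_range_mul_of_summable_norm n1 n2
    rw [s1.tsum_eq, s2.tsum_eq] at s4
    have : A (s + h) * q.sum h = deriv q.sum h := by
      rw [zero_add] at s3 s4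
      refine s4.unique ?_
      convert! s3 using 1
      funext k
      simp only [ContinuousLinearMap.apply_apply, FormalMultilinearSeries.apply_eq_pow_smul_coeff, smul_apply,
        FormalMultilinearSeries.derivSeries_coeff_one, hqc]
      have := psol_succ p.coeff k
      rw [← hc] at this
      rw [← Nat.cast_smul_eq_nsmul ℝ, Nat.cast_add, Nat.cast_one, this, Finset.smul_sum]
      refine Finset.sum_congr rfl fun i hi => ?_
      have hik : i ≤ k := by simpa [Nat.lt_succ_iff] using hi
      rw [smul_mul_smul_comm, ← pow_add, Nat.add_sub_cancel' hik]
    rw [this]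
    exact hd.hasDerivAt
  refine ⟨fun t => q.sum (t - s), ?_, ?_, ?_⟩
  · exact AnalyticAt.fun_comp_of_eq hG.analyticAt (by fun_prop) (by simp)
  · have := hG.coeff_zero (fun i => 0)
    simp only [sub_self]
    rw [← this]
    simp [q, hc, psol]
  · have h0 : ∀ᶠ t in 𝓝 s, t - s ∈ Metric.eball (0:ℝ) (min r q.radius) := by
      have : Tendsto (fun t : ℝ => t - s) (𝓝 s) (𝓝 0) := by
        have : ContinuousAt (fun t : ℝ => t - s) s := by fun_prop
        simpa [ContinuousAt] using this
      exact this.eventually (Metric.eball_mem_nhds _ (lt_min hp.r_pos hqr))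
    filter_upwards [h0] with t ht
    have := key _ ht
    rw [add_sub_cancel] at this
    exact this.comp_sub_const t s

theorem md_mul {l m k : ℕ} {F : ℝ → Matrix (Fin l) (Fin m) ℝ} {G : ℝ → Matrix (Fin m) (Fin k) ℝ}
    {F' : Matrix (Fin l) (Fin m) ℝ} {G' : Matrix (Fin m) (Fin k) ℝ} {t : ℝ}
    (hF : ∀ a b, HasDerivAt (fun s => F s a b) (F' a b) t)
    (hG : ∀ a b, HasDerivAt (fun s => G s a b) (G' a b) t) (a : Fin l) (b : Fin k) :
    HasDerivAt (fun s => (F s * G s) a b) ((F' * G t + F t * G') a b) t := by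
  simp only [Matrix.mul_apply, Matrix.add_apply, ← Finset.sum_add_distrib]
  exact HasDerivAt.fun_sum fun j _ => (hF a j).mul (hG j b)

theorem ma_mul {l m k : ℕ} {F : ℝ → Matrix (Fin l) (Fin m) ℝ} {G : ℝ → Matrix (Fin m) (Fin k) ℝ}
    {t : ℝ}
    (hF : ∀ a b, AnalyticAt ℝ (fun s => F s a b) t)
    (hG : ∀ a b, AnalyticAt ℝ (fun s => G s a b) t) (a : Fin l) (b : Fin k) :
    AnalyticAt ℝ (fun s => (F s * G s) a b) t := by
  simp only [Matrix.mul_apply]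
  exact Finset.analyticAt_fun_sum _ fun j _ => (hF a j).mul (hG j b)

theorem loc_const {f : ℝ → ℝ} {s : ℝ} (h : ∀ᶠ t in 𝓝 s, HasDerivAt f 0 t) :
    ∀ᶠ t in 𝓝 s, f t = f s := by
  obtain ⟨δ, hδ, hb⟩ := Metric.eventually_nhds_iff_ball.1 h
  filter_upwards [Metric.ball_mem_nhds s hδ] with t ht
  refine Metric.isOpen_ball.is_const_of_deriv_eq_zero (convex_ball s δ).isPreconnected ?_ ?_ ht
    (Metric.mem_ball_self hδ)
  · exact fun x hx => (hb x hx).differentiableAt.differentiableWithinAt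
  · exact fun x hx => (hb x hx).deriv

section
attribute [local instance] Matrix.linftyOpNormedRing Matrix.linftyOpNormedAlgebra

theorem loc_sol {n : ℕ} (A : ℝ → Matrix (Fin n) (Fin n) ℝ) (s : ℝ)
    (hA : ∀ a b, AnalyticAt ℝ (fun t => A t a b) s) :
    ∃ Y : ℝ → Matrix (Fin n) (Fin n) ℝ, (∀ a b, AnalyticAt ℝ (fun t => Y t a b) s) ∧ Y s = 1 ∧
      ∀ᶠ t in 𝓝 s, ∀ a b, HasDerivAt (fun t => Y t a b) ((A t * Y t) a b) t := by
  have hA' : AnalyticAt ℝ A s := by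
    have : A = fun t => ∑ a, ∑ b, A t a b • Matrix.single a b (1:ℝ) := by
      funext t
      conv_lhs => rw [Matrix.matrix_eq_sum_single (A t)]
      simp
    rw [this]
    refine Finset.analyticAt_fun_sum _ fun a _ => Finset.analyticAt_fun_sum _ fun b _ => ?_
    exact (hA a b).smul analyticAt_const
  have : CompleteSpace (Matrix (Fin n) (Fin n) ℝ) := FiniteDimensional.complete ℝ _
  obtain ⟨Y, hY, hY1, hY2⟩ := analytic_ode A s hA'
  let e : Fin n → Fin n → (Matrix (Fin n) (Fin n) ℝ →L[ℝ] ℝ) := fun a b =>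
    LinearMap.toContinuousLinearMap (Matrix.entryLinearMap ℝ ℝ a b)
  refine ⟨Y, fun a b => ?_, hY1, ?_⟩
  · exact ((e a b).analyticAt _).comp hY
  · filter_upwards [hY2] with t ht a b
    exact (e a b).hasFDerivAt.comp_hasDerivAt t ht
end

theorem loc_pair {n : ℕ} (A : ℝ → Matrix (Fin n) (Fin n) ℝ) (s : ℝ)
    (hA : ∀ a b, AnalyticAt ℝ (fun t => A t a b) s) (P : ℝ → Matrix (Fin n) (Fin n) ℝ)
    (hP : ∀ᶠ t in 𝓝 s, ∀ a b, HasDerivAt (fun t => P t a b) ((A t * P t) a b) t) :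
    ∃ Y Z : ℝ → Matrix (Fin n) (Fin n) ℝ, (∀ a b, AnalyticAt ℝ (fun t => Z t a b) s) ∧
      (∀ᶠ t in 𝓝 s, ∀ a b, HasDerivAt (fun t => Z t a b) ((-(Z t * A t)) a b) t) ∧
      (∀ᶠ t in 𝓝 s, Z t * Y t = 1) ∧ ∀ᶠ t in 𝓝 s, P t = Y t * P s := by
  obtain ⟨Y, hY, hY1, hY2⟩ := loc_sol A s hA
  obtain ⟨W, hW, hW1, hW2⟩ := loc_sol (fun t => -(A t).transpose) s (fun a b => by
    simp only [Matrix.neg_apply, Matrix.transpose_apply]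
    exact (hA b a).fun_neg)
  have hZ : ∀ᶠ t in 𝓝 s, ∀ a b,
      HasDerivAt (fun t => (W t).transpose a b) ((-((W t).transpose * A t)) a b) t := by
    filter_upwards [hW2] with t ht a b
    convert! ht b a using 1
    rw [← Matrix.transpose_apply (_ * W t) a b, Matrix.transpose_mul]
    simp
  have gen : ∀ P : ℝ → Matrix (Fin n) (Fin n) ℝ,
     (∀ᶠ t in 𝓝 s, ∀ a b, HasDerivAt (fun t => P t a b) ((A t * P t) a b) t) →
     ∀ᶠ t in 𝓝 s, (W t).transpose * P t = P s := by
    intro P hP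
    have : ∀ a b, ∀ᶠ t in 𝓝 s, ((W t).transpose * P t) a b = ((W s).transpose * P s) a b := by
      intro a b
      refine loc_const (f := fun t => ((W t).transpose * P t) a b) ?_
      filter_upwards [hZ, hP] with t h1 h2
      convert! md_mul h1 h2 a b using 1
      simp [Matrix.mul_assoc]
    have h2 : ∀ᶠ t in 𝓝 s, ∀ a b, ((W t).transpose * P t) a b = ((W s).transpose * P s) a b := by
      simpa only [eventually_all] using this
    filter_upwards [h2] with t ht
    ext a b
    rw [ht, hW1]; simp
  have hZY : ∀ᶠ t in 𝓝 s, (W t).transpose * Y t = 1 := by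
    simpa [hY1] using gen Y hY2
  refine ⟨Y, fun t => (W t).transpose, fun a b => hW b a, hZ, hZY, ?_⟩
  filter_upwards [hZY, gen P hP] with t h1 h2
  rw [← h2, ← Matrix.mul_assoc, mul_eq_one_comm.1 h1, Matrix.one_mul]

theorem inv_sol {n : ℕ} (A : ℝ → Matrix (Fin n) (Fin n) ℝ) (α β t₀ : ℝ)
    (hA : ∀ a b, AnalyticOnNhd ℝ (fun t => A t a b) (Set.Ioo α β))
    (P : ℝ → Matrix (Fin n) (Fin n) ℝ)
    (hP : ∀ t ∈ Set.Ioo α β, ∀ a b, HasDerivAt (fun t => P t a b) ((A t * P t) a b) t)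
    (ht₀ : t₀ ∈ Set.Ioo α β) (hP1 : P t₀ = 1) :
    ∃ Q : ℝ → Matrix (Fin n) (Fin n) ℝ, (∀ a b, AnalyticOnNhd ℝ (fun t => Q t a b) (Set.Ioo α β)) ∧
      (∀ t ∈ Set.Ioo α β, ∀ a b, HasDerivAt (fun t => Q t a b) ((-(Q t * A t)) a b) t) ∧
      (∀ t ∈ Set.Ioo α β, P t * Q t = 1) := by
  have loc := fun s (hs : s ∈ Set.Ioo α β) => loc_pair A s (fun a b => hA a b s hs) P (by
    filter_upwards [isOpen_Ioo.mem_nhds hs] with t ht using hP t ht)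
  have hu : ∀ t ∈ Set.Ioo α β, IsUnit (P t) := by
    intro t ht
    have := isPreconnected_Ioo.induction₂ (s := Set.Ioo α β)
      (fun x y => IsUnit (P x) ↔ IsUnit (P y)) ?_ (fun x y z _ _ _ h1 h2 => h1.trans h2)
      (fun x y _ _ h => h.symm) ht₀ ht
    · rw [← this, hP1]; exact isUnit_one
    · intro s hs
      obtain ⟨Y, Z, -, -, h1, h2⟩ := loc s hs
      refine Filter.Eventually.filter_mono nhdsWithin_le_nhds ?_
      filter_upwards [h1, h2] with t h1 h2
      rw [h2]
      have hY : IsUnit (Y t) := IsUnit.of_mul_eq_one_right _ h1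
      constructor
      · exact fun h => hY.mul h
      · intro h
        have := (IsUnit.of_mul_eq_one _ h1).mul h
        rwa [← Matrix.mul_assoc, h1, Matrix.one_mul] at this
  have hQ : ∀ s ∈ Set.Ioo α β, ∃ Z : ℝ → Matrix (Fin n) (Fin n) ℝ,
      (∀ a b, AnalyticAt ℝ (fun t => Z t a b) s) ∧
      (∀ᶠ t in 𝓝 s, ∀ a b, HasDerivAt (fun t => Z t a b) ((-(Z t * A t)) a b) t) ∧
      ∀ᶠ t in 𝓝 s, (P t)⁻¹ = (P s)⁻¹ * Z t := by
    intro s hs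
    obtain ⟨Y, Z, h3, h4, h1, h2⟩ := loc s hs
    refine ⟨Z, h3, h4, ?_⟩
    filter_upwards [h1, h2] with t h1 h2
    rw [h2, Matrix.mul_inv_rev, Matrix.inv_eq_left_inv h1]
  refine ⟨fun t => (P t)⁻¹, fun a b s hs => ?_, fun s hs a b => ?_, fun t ht => ?_⟩
  · obtain ⟨Z, h3, h4, h5⟩ := hQ s hs
    refine (ma_mul (F := fun _ => (P s)⁻¹) (fun a b => analyticAt_const) h3 a b).congr ?_
    filter_upwards [h5] with t ht
    rw [ht]
  · obtain ⟨Z, h3, h4, h5⟩ := hQ s hs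
    have := md_mul (F := fun _ => (P s)⁻¹) (F' := 0) (t := s)
      (fun a b => by simpa using hasDerivAt_const s _) h4.self_of_nhds a b
    refine (this.congr_of_eventuallyEq ?_).congr_deriv ?_
    · filter_upwards [h5] with t ht
      rw [ht]
    · have h6 := h5.self_of_nhds
      simp only [zero_mul, zero_add, Matrix.mul_neg, ← Matrix.mul_assoc, ← h6]
  · exact Matrix.mul_nonsing_inv _ ((Matrix.isUnit_iff_isUnit_det _).1 (hu t ht))

theorem van_b (f : ℕ → ℝ → ℝ) (α β t₁ : ℝ)
    (hf : ∀ i, ∀ t ∈ Set.Ioo α β, HasDerivAt (f i) (f (i+1) t) t)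
    (h0 : AnalyticOnNhd ℝ (f 0) (Set.Ioo α β)) (ht₁ : t₁ ∈ Set.Ioo α β)
    (hz : f 0 =ᶠ[𝓝 t₁] 0) (i : ℕ) : ∀ t ∈ Set.Ioo α β, f i t = 0 := by
  induction i with
  | zero => exact h0.eqOn_zero_of_preconnected_of_eventuallyEq_zero isPreconnected_Ioo ht₁ hz
  | succ i ih =>
    intro t ht
    refine (hf i t ht).unique ((hasDerivAt_const t (0:ℝ)).congr_of_eventuallyEq ?_)
    filter_upwards [isOpen_Ioo.mem_nhds ht] with s hs using ih s hs

theorem van_a (f : ℕ → ℝ → ℝ) (α β t₁ : ℝ)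
    (hf : ∀ i, ∀ t ∈ Set.Ioo α β, HasDerivAt (f i) (f (i+1) t) t)
    (h0 : AnalyticOnNhd ℝ (f 0) (Set.Ioo α β)) (ht₁ : t₁ ∈ Set.Ioo α β)
    (hz : ∀ i, f i t₁ = 0) : ∀ t ∈ Set.Ioo α β, f 0 t = 0 := by
  have hid : ∀ i, ∀ t ∈ Set.Ioo α β, iteratedDeriv i (f 0) t = f i t := by
    intro i
    induction i with
    | zero => simp
    | succ i ih =>
      intro t ht
      rw [iteratedDeriv_succ]
      refine HasDerivAt.deriv ((hf i t ht).congr_of_eventuallyEq ?_)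
      filter_upwards [isOpen_Ioo.mem_nhds ht] with s hs using ih s hs
  refine h0.eqOn_zero_of_preconnected_of_eventuallyEq_zero isPreconnected_Ioo ht₁ ?_
  have h1 := (h0 t₁ ht₁).hasFPowerSeriesAt
  refine (HasFPowerSeriesAt.locally_zero_iff h1).2 ?_
  ext i
  simp [hid i t₁ ht₁, hz i, FormalMultilinearSeries.ofScalars]

theorem md_mulVec {l m : ℕ} {F : ℝ → Matrix (Fin l) (Fin m) ℝ} {x : ℝ → Fin m → ℝ}
    {F' : Matrix (Fin l) (Fin m) ℝ} {x' : Fin m → ℝ} {t : ℝ}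
    (hF : ∀ a b, HasDerivAt (fun s => F s a b) (F' a b) t)
    (hx : ∀ a, HasDerivAt (fun s => x s a) (x' a) t) (a : Fin l) :
    HasDerivAt (fun s => (F s).mulVec (x s) a) ((F'.mulVec (x t) + (F t).mulVec x') a) t := by
  simp only [Matrix.mulVec, dotProduct, Pi.add_apply, ← Finset.sum_add_distrib]
  exact HasDerivAt.fun_sum fun j _ => (hF a j).mul (hx j)

theorem md_cmulVec {l m : ℕ} (F : Matrix (Fin l) (Fin m) ℝ) {x : ℝ → Fin m → ℝ}
    {x' : Fin m → ℝ} {t : ℝ}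
    (hx : ∀ a, HasDerivAt (fun s => x s a) (x' a) t) (a : Fin l) :
    HasDerivAt (fun s => F.mulVec (x s) a) (F.mulVec x' a) t := by
  simpa using md_mulVec (F := fun _ => F) (F' := 0)
    (fun a b => by simpa using hasDerivAt_const t _) hx a

theorem md_dot {m : ℕ} (p : Fin m → ℝ) {x : ℝ → Fin m → ℝ}
    {x' : Fin m → ℝ} {t : ℝ}
    (hx : ∀ a, HasDerivAt (fun s => x s a) (x' a) t) :
    HasDerivAt (fun s => dotProduct p (x s)) (dotProduct p x') t := by
  simp only [dotProduct]
  exact HasDerivAt.fun_sum fun j _ => (hx j).const_mul (p j)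

theorem md_vecMul {l m : ℕ} (p : Fin l → ℝ) {F : ℝ → Matrix (Fin l) (Fin m) ℝ}
    {F' : Matrix (Fin l) (Fin m) ℝ} {t : ℝ}
    (hF : ∀ a b, HasDerivAt (fun s => F s a b) (F' a b) t) (b : Fin m) :
    HasDerivAt (fun s => Matrix.vecMul p (F s) b) (Matrix.vecMul p F' b) t :=
  md_dot p (x := fun s a => F s a b) (fun a => hF a b)

theorem antideriv {f : ℝ → ℝ} {α β : ℝ} (h0 : (0:ℝ) ∈ Set.Ioo α β)
    (hf : ContinuousOn f (Set.Ioo α β)) :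
    ∃ F : ℝ → ℝ, F 0 = 0 ∧ ∀ t ∈ Set.Ioo α β, HasDerivAt F (f t) t := by
  refine ⟨fun t => ∫ x in (0:ℝ)..t, f x, by simp, fun t ht => ?_⟩
  refine intervalIntegral.integral_hasDerivAt_right ?_ ?_ (hf.continuousAt (isOpen_Ioo.mem_nhds ht))
  · refine (hf.mono ?_).intervalIntegrable
    exact Set.OrdConnected.uIcc_subset Set.ordConnected_Ioo h0 ht
  · exact hf.stronglyMeasurableAtFilter isOpen_Ioo t ht

section core
open Matrix

variable {n mm : ℕ} {α β T : ℝ} {N : ℕ → ℝ → Matrix (Fin n) (Fin mm) ℝ}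

theorem dual_a (hN : ∀ i, ∀ t ∈ Set.Ioo α β, ∀ a b, HasDerivAt (fun s => N i s a b) (N (i+1) t a b) t)
    (hN0 : ∀ a b, AnalyticOnNhd ℝ (fun s => N 0 s a b) (Set.Ioo α β))
    (p : Fin n → ℝ) {t₁ : ℝ} (ht₁ : t₁ ∈ Set.Ioo α β) (hz : ∀ i, p ᵥ* N i t₁ = 0) :
    ∀ t ∈ Set.Ioo α β, p ᵥ* N 0 t = 0 := by
  intro t ht
  ext j
  refine van_a (fun i t => (p ᵥ* N i t) j) α β t₁ (fun i t ht => md_vecMul p (hN i t ht) j) ?_ ht₁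
    (fun i => by simp [hz i]) t ht
  intro s hs
  simp only [Matrix.vecMul, dotProduct]
  exact Finset.analyticAt_fun_sum _ fun a _ => analyticAt_const.mul (hN0 a j s hs)

theorem dual_b (hN : ∀ i, ∀ t ∈ Set.Ioo α β, ∀ a b, HasDerivAt (fun s => N i s a b) (N (i+1) t a b) t)
    (hN0 : ∀ a b, AnalyticOnNhd ℝ (fun s => N 0 s a b) (Set.Ioo α β))
    (p : Fin n → ℝ) {t₁ : ℝ} (ht₁ : t₁ ∈ Set.Ioo α β) (hz : ∀ᶠ t in 𝓝 t₁, p ᵥ* N 0 t = 0) (i : ℕ) :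
    ∀ t ∈ Set.Ioo α β, p ᵥ* N i t = 0 := by
  intro t ht
  ext j
  refine van_b (fun i t => (p ᵥ* N i t) j) α β t₁ (fun i t ht => md_vecMul p (hN i t ht) j) ?_ ht₁
    ?_ i t ht
  · intro s hs
    simp only [Matrix.vecMul, dotProduct]
    exact Finset.analyticAt_fun_sum _ fun a _ => analyticAt_const.mul (hN0 a j s hs)
  · filter_upwards [hz] with t ht
    simp [ht]

/-- a pairing condition on all controls forces orthogonality -/
theorem dual_c (hT : 0 < T) (h0 : (0:ℝ) ∈ Set.Ioo α β) (hTT : T ∈ Set.Ioo α β)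
    (hN : ∀ i, ∀ t ∈ Set.Ioo α β, ∀ a b, HasDerivAt (fun s => N i s a b) (N (i+1) t a b) t)
    (hN0 : ∀ a b, AnalyticOnNhd ℝ (fun s => N 0 s a b) (Set.Ioo α β))
    (p : Fin n → ℝ) (r : Fin mm → ℝ)
    (H : ∀ u u' : ℝ → Fin mm → ℝ, u 0 = 0 → (∀ j, ContinuousOn (fun t => u' t j) (Set.Ioo α β)) →
      (∀ t ∈ Set.Ioo α β, ∀ j, HasDerivAt (fun s => u s j) (u' t j) t) →
      ∃ g : ℝ → Fin n → ℝ, g 0 = 0 ∧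
        (∀ t ∈ Set.Ioo α β, ∀ a, HasDerivAt (fun s => g s a) ((N 0 t *ᵥ u t) a) t) ∧
        r ⬝ᵥ u T + p ⬝ᵥ g T = 0) :
    r = 0 ∧ ∀ i, ∀ t ∈ Set.Ioo α β, p ᵥ* N i t = 0 := by
  have hsub : Set.Icc 0 T ⊆ Set.Ioo α β := Set.OrdConnected.out Set.ordConnected_Ioo h0 hTT
  have hNc : ∀ i j, ContinuousOn (fun t => (p ᵥ* N i t) j) (Set.Ioo α β) := fun i j t ht =>
    (md_vecMul p (hN i t ht) j).continuousAt.continuousWithinAt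
  have hp : ∀ i, ∀ t ∈ Set.Ioo α β, p ᵥ* N i t = 0 := by
    obtain ⟨g, hg0, hg, hgT⟩ := H (fun t => (t * (T - t)) • (p ᵥ* N 0 t))
      (fun t => (T - 2 * t) • (p ᵥ* N 0 t) + (t * (T - t)) • (p ᵥ* N 1 t)) (by simp)
      (fun j => by
        simp only [Pi.add_apply, Pi.smul_apply, smul_eq_mul]
        have h1 := hNc 0 j
        have h2 := hNc 1 j
        fun_prop)
      (fun t ht j => by
        simp only [Pi.add_apply, Pi.smul_apply, smul_eq_mul]
        have h1 : HasDerivAt (fun t : ℝ => t * (T - t)) (T - 2 * t) t := by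
          refine ((hasDerivAt_id t).fun_mul ((hasDerivAt_id t).const_sub T)).congr_deriv ?_
          simp; ring
        exact h1.fun_mul (md_vecMul p (hN 0 t ht) j))
    have hgT' : p ⬝ᵥ g T = 0 := by simpa using hgT
    have hd : ∀ t ∈ Set.Ioo α β, HasDerivAt (fun s => p ⬝ᵥ g s)
        ((t * (T - t)) * ((p ᵥ* N 0 t) ⬝ᵥ (p ᵥ* N 0 t))) t := by
      intro t ht
      refine (md_dot p (hg t ht)).congr_deriv ?_
      rw [dotProduct_mulVec, dotProduct_smul, smul_eq_mul]
    have hnn : ∀ v : Fin mm → ℝ, 0 ≤ v ⬝ᵥ v := fun v =>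
      Finset.sum_nonneg fun i _ => mul_self_nonneg _
    have hmono : MonotoneOn (fun s => p ⬝ᵥ g s) (Set.Icc 0 T) := by
      refine monotoneOn_of_deriv_nonneg (convex_Icc 0 T) ?_ ?_ ?_
      · exact fun t ht => (hd t (hsub ht)).continuousAt.continuousWithinAt
      · intro t ht
        exact (hd t (hsub (interior_subset ht))).differentiableAt.differentiableWithinAt
      · intro t ht
        rw [(hd t (hsub (interior_subset ht))).deriv]
        have := interior_subset ht
        exact mul_nonneg (mul_nonneg this.1 (by linarith [this.2])) (hnn _)
    have hzero : ∀ t ∈ Set.Icc 0 T, p ⬝ᵥ g t = 0 := by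
      intro t ht
      refine le_antisymm ?_ ?_
      · rw [← hgT']; exact hmono ht ⟨hT.le, le_rfl⟩ ht.2
      · have := hmono ⟨le_rfl, hT.le⟩ ht ht.1
        simpa [hg0] using this
    have hNz : ∀ t ∈ Set.Ioo 0 T, p ᵥ* N 0 t = 0 := by
      intro t ht
      have h1 := (hd t (hsub ⟨ht.1.le, ht.2.le⟩)).unique
        ((hasDerivAt_const t (0:ℝ)).congr_of_eventuallyEq (by
          filter_upwards [isOpen_Ioo.mem_nhds ht] with s hs using hzero s ⟨hs.1.le, hs.2.le⟩))
      have h2 : t * (T - t) ≠ 0 := (mul_pos ht.1 (sub_pos.2 ht.2)).ne'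
      exact dotProduct_self_eq_zero.1 ((mul_eq_zero.1 h1).resolve_left h2)
    have hmid : T / 2 ∈ Set.Ioo 0 T := ⟨by linarith, by linarith⟩
    intro i
    refine dual_b hN hN0 p (hsub ⟨hmid.1.le, hmid.2.le⟩) ?_ i
    filter_upwards [isOpen_Ioo.mem_nhds hmid] with s hs using hNz s hs
  refine ⟨?_, hp⟩
  obtain ⟨g, hg0, hg, hgT⟩ := H (fun t => t • r) (fun t => r) (by simp)
    (fun j => continuousOn_const) (fun t ht j => by
      simpa using (hasDerivAt_id t).mul_const (r j))
  have hd : ∀ t ∈ Set.Ioo α β, HasDerivAt (fun s => p ⬝ᵥ g s) 0 t := by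
    intro t ht
    refine (md_dot p (hg t ht)).congr_deriv ?_
    rw [dotProduct_mulVec, hp 0 t ht, zero_dotProduct]
  have : p ⬝ᵥ g T = p ⬝ᵥ g 0 := isOpen_Ioo.is_const_of_deriv_eq_zero (f := fun s => p ⬝ᵥ g s)
    isPreconnected_Ioo
    (fun t ht => (hd t ht).differentiableAt.differentiableWithinAt)
    (fun t ht => (hd t ht).deriv) hTT h0
  rw [this, hg0, dotProduct_zero, add_zero, dotProduct_smul, smul_eq_mul] at hgT
  exact dotProduct_self_eq_zero.1 ((mul_eq_zero.1 hgT).resolve_left hT.ne')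

end core

/-- Proposition 3.4 of the paper; Glass–Rosier reachability
test for linear time-varying systems in which the derivative of the control
appears. With `𝒜, ℬ` real-analytic on `(−ε, T+ε)`, `ℳ₀ = ℬ + 𝒜𝒞`,
`ℳ_{i+1} = ℳ_i' − 𝒜 ℳ_i`, and `φ` the fundamental solution of `ẋ = 𝒜(t)x`,
the reachable set from `0` at time `T` with `C¹` controls vanishing at `0`
equals `𝒞 ℝ^m + Span{φ(T,t₀) ℳ_i(t₀) u : u ∈ ℝ^m, i ≥ 0}` for every
`t₀ ∈ [0,T]`. -/
theorem stmt_3 (n mm : ℕ) (hn : 1 ≤ n) (hmm : 1 ≤ mm) (T ε : ℝ)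
    (hT : 0 < T) (hε : 0 < ε)
    (𝒜 : ℝ → Matrix (Fin n) (Fin n) ℝ) (ℬ : ℝ → Matrix (Fin n) (Fin mm) ℝ)
    (𝒞 : Matrix (Fin n) (Fin mm) ℝ)
    (h𝒜 : ∀ a b : Fin n, AnalyticOnNhd ℝ (fun t => 𝒜 t a b) (Set.Ioo (-ε) (T + ε)))
    (hℬ : ∀ (a : Fin n) (b : Fin mm),
      AnalyticOnNhd ℝ (fun t => ℬ t a b) (Set.Ioo (-ε) (T + ε)))
    -- the sequence ℳ_i : ℳ₀ = ℬ + 𝒜 𝒞 and ℳ_{i+1} = ℳ_i' − 𝒜 ℳ_i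
    (ℳ : ℕ → ℝ → Matrix (Fin n) (Fin mm) ℝ)
    (hM0 : ∀ t, ℳ 0 t = ℬ t + 𝒜 t * 𝒞)
    (hMrec : ∀ (i : ℕ), ∀ t ∈ Set.Ioo (-ε) (T + ε), ∀ (a : Fin n) (b : Fin mm),
      HasDerivAt (fun s => ℳ i s a b) ((ℳ (i + 1) t + 𝒜 t * ℳ i t) a b) t)
    -- the fundamental solution φ of ẋ = 𝒜(t) x
    (φ : ℝ → ℝ → Matrix (Fin n) (Fin n) ℝ)
    (hφ1 : ∀ s, φ s s = 1)
    (hφ2 : ∀ s, ∀ t ∈ Set.Ioo (-ε) (T + ε), ∀ a b : Fin n,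
      HasDerivAt (fun τ => φ τ s a b) ((𝒜 t * φ t s) a b) t) :
    ∀ t₀ ∈ Set.Icc (0:ℝ) T,
      {xT : Fin n → ℝ |
        ∃ (u u' : ℝ → Fin mm → ℝ) (x : ℝ → Fin n → ℝ),
          u 0 = 0 ∧ ContinuousOn u' (Set.Icc 0 T) ∧
          (∀ t ∈ Set.Icc (0:ℝ) T, ∀ j : Fin mm,
            HasDerivAt (fun s => u s j) (u' t j) t) ∧
          (∀ t ∈ Set.Icc (0:ℝ) T, ∀ a : Fin n,
            HasDerivAt (fun s => x s a)
              ((𝒜 t).mulVec (x t) a + (ℬ t).mulVec (u t) a + 𝒞.mulVec (u' t) a) t) ∧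
          x 0 = 0 ∧ x T = xT}
      = ↑(Submodule.span ℝ
          ({y : Fin n → ℝ | ∃ v : Fin mm → ℝ, y = 𝒞.mulVec v} ∪
           {y : Fin n → ℝ | ∃ (i : ℕ) (v : Fin mm → ℝ),
             y = (φ T t₀ * ℳ i t₀).mulVec v})) := by
  intro t₀ ht₀
  have hsub : Set.Icc 0 T ⊆ Set.Ioo (-ε) (T + ε) := fun t ht =>
    ⟨by linarith [ht.1], by linarith [ht.2]⟩
  have h0I : (0:ℝ) ∈ Set.Ioo (-ε) (T + ε) := hsub ⟨le_rfl, hT.le⟩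
  have hTI : T ∈ Set.Ioo (-ε) (T + ε) := hsub ⟨hT.le, le_rfl⟩
  have ht₀I := hsub ht₀
  set P : ℝ → Matrix (Fin n) (Fin n) ℝ := fun t => φ t t₀ with hPdef
  have hP : ∀ t ∈ Set.Ioo (-ε) (T + ε), ∀ a b,
      HasDerivAt (fun s => P s a b) ((𝒜 t * P t) a b) t := hφ2 t₀
  obtain ⟨Q, hQa, hQd, hPQ⟩ := inv_sol 𝒜 (-ε) (T + ε) t₀ h𝒜 P hP ht₀I (hφ1 t₀)
  have hQ0 : Q t₀ = 1 := by
    have := hPQ t₀ ht₀I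
    have h1 : P t₀ = 1 := hφ1 t₀
    rwa [h1, Matrix.one_mul] at this
  set N : ℕ → ℝ → Matrix (Fin n) (Fin mm) ℝ := fun i t => Q t * ℳ i t with hNdef
  have hN : ∀ i, ∀ t ∈ Set.Ioo (-ε) (T + ε), ∀ a b,
      HasDerivAt (fun s => N i s a b) (N (i+1) t a b) t := by
    intro i t ht a b
    refine (md_mul (hQd t ht) (hMrec i t ht) a b).congr_deriv ?_
    simp [hNdef, Matrix.mul_add, Matrix.mul_assoc]
  have hN0 : ∀ a b, AnalyticOnNhd ℝ (fun s => N 0 s a b) (Set.Ioo (-ε) (T + ε)) := by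
    intro a b s hs
    refine ma_mul (fun a b => hQa a b s hs) (fun a b => ?_) a b
    simp only [hM0, Matrix.add_apply]
    exact (hℬ a b s hs).add (ma_mul (G := fun _ => 𝒞) (fun a b => h𝒜 a b s hs)
      (fun a b => analyticAt_const) a b)
  have hdual : ∀ q : Module.Dual ℝ (Fin n → ℝ), ∃ w : Fin n → ℝ, ∀ x, q x = dotProduct w x := by
    intro q
    refine ⟨fun a => q (Pi.single a 1), fun x => ?_⟩
    conv_lhs => rw [pi_eq_sum_univ' x]
    simp [dotProduct, mul_comm]
  let RS : Submodule ℝ (Fin n → ℝ) :=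
    { carrier := {xT : Fin n → ℝ |
        ∃ (u u' : ℝ → Fin mm → ℝ) (x : ℝ → Fin n → ℝ),
          u 0 = 0 ∧ ContinuousOn u' (Set.Icc 0 T) ∧
          (∀ t ∈ Set.Icc (0:ℝ) T, ∀ j : Fin mm,
            HasDerivAt (fun s => u s j) (u' t j) t) ∧
          (∀ t ∈ Set.Icc (0:ℝ) T, ∀ a : Fin n,
            HasDerivAt (fun s => x s a)
              ((𝒜 t).mulVec (x t) a + (ℬ t).mulVec (u t) a + 𝒞.mulVec (u' t) a) t) ∧
          x 0 = 0 ∧ x T = xT}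
      zero_mem' := by
        refine ⟨0, 0, 0, rfl, continuousOn_const, fun t _ j => ?_, fun t _ a => ?_, rfl, rfl⟩
        · simpa using hasDerivAt_const t (0:ℝ)
        · simpa using hasDerivAt_const t (0:ℝ)
      add_mem' := by
        rintro _ _ ⟨u, u', x, h1, h2, h3, h4, h5, rfl⟩ ⟨v, v', y, k1, k2, k3, k4, k5, rfl⟩
        refine ⟨u + v, u' + v', x + y, by simp [h1, k1], h2.add k2,
          fun t ht j => (h3 t ht j).add (k3 t ht j), fun t ht a => ?_, by simp [h5, k5], rfl⟩
        refine ((h4 t ht a).add (k4 t ht a)).congr_deriv ?_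
        simp only [Pi.add_apply, Matrix.mulVec_add]
        ring
      smul_mem' := by
        rintro c _ ⟨u, u', x, h1, h2, h3, h4, h5, rfl⟩
        refine ⟨c • u, c • u', c • x, by simp [h1], h2.const_smul c,
          fun t ht j => (h3 t ht j).const_mul c, fun t ht a => ?_, by simp [h5], rfl⟩
        refine ((h4 t ht a).const_mul c).congr_deriv ?_
        simp only [Pi.smul_apply, Matrix.mulVec_smul, smul_eq_mul]
        ring }
  change (RS : Set (Fin n → ℝ)) = _
  rw [SetLike.coe_set_eq]
  refine le_antisymm ?_ ?_
  · -- reachable points lie in the span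
    rintro _ ⟨u, u', x, h1, h2, h3, h4, h5, rfl⟩
    rw [← Subspace.forall_mem_dualAnnihilator_apply_eq_zero_iff]
    intro q hq
    rw [Submodule.mem_dualAnnihilator] at hq
    obtain ⟨w, hw⟩ := hdual q
    have hq1 : ∀ v, dotProduct w (𝒞.mulVec v) = 0 := fun v => by
      rw [← hw]; exact hq _ (Submodule.subset_span (Or.inl ⟨v, rfl⟩))
    have hq2 : ∀ i v, dotProduct w ((P T * ℳ i t₀).mulVec v) = 0 := fun i v => by
      rw [← hw]; exact hq _ (Submodule.subset_span (Or.inr ⟨i, v, rfl⟩))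
    rw [hw]
    set p := Matrix.vecMul w (P T) with hp
    have hpN : ∀ t ∈ Set.Ioo (-ε) (T + ε), Matrix.vecMul p (N 0 t) = 0 := by
      refine dual_a hN hN0 p ht₀I fun i => ?_
      rw [hp, hNdef]
      simp only [hQ0, Matrix.one_mul, Matrix.vecMul_vecMul]
      refine dotProduct_eq_zero _ fun v => ?_
      rw [← Matrix.dotProduct_mulVec]
      exact hq2 i v
    have hz : ∀ t ∈ Set.Icc 0 T, ∀ a, HasDerivAt (fun s => (x s - 𝒞.mulVec (u s)) a)
        (((𝒜 t).mulVec (x t) + (ℬ t).mulVec (u t)) a) t := by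
      intro t ht a
      refine ((h4 t ht a).sub (md_cmulVec 𝒞 (h3 t ht) a)).congr_deriv ?_
      simp
    have hd : ∀ t ∈ Set.Icc 0 T,
        HasDerivAt (fun s => dotProduct p ((Q s).mulVec (x s - 𝒞.mulVec (u s)))) 0 t := by
      intro t ht
      refine (md_dot p (md_mulVec (hQd t (hsub ht)) (hz t ht))).congr_deriv ?_
      have h := hpN t (hsub ht)
      have e : (-(Q t * 𝒜 t)).mulVec (x t - 𝒞.mulVec (u t)) +
          (Q t).mulVec ((𝒜 t).mulVec (x t) + (ℬ t).mulVec (u t)) = (N 0 t).mulVec (u t) := by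
        simp only [hNdef, hM0, Matrix.neg_mulVec, Matrix.mulVec_sub, Matrix.mulVec_add,
          Matrix.mulVec_mulVec, Matrix.mul_add, Matrix.add_mulVec, Matrix.neg_mul, Matrix.mul_assoc]
        abel
      rw [e, Matrix.dotProduct_mulVec, h, zero_dotProduct]
    have hc := constant_of_has_deriv_right_zero
      (f := fun s => dotProduct p ((Q s).mulVec (x s - 𝒞.mulVec (u s)))) (a := 0) (b := T)
      (fun t ht => (hd t ht).continuousAt.continuousWithinAt)
      (fun t ht => (hd t ⟨ht.1, ht.2.le⟩).hasDerivWithinAt) T ⟨hT.le, le_rfl⟩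
    simp only [h5, h1, Matrix.mulVec_zero, sub_zero, dotProduct_zero] at hc
    rw [hp, ← Matrix.dotProduct_mulVec, Matrix.mulVec_mulVec, hPQ T hTI, Matrix.one_mulVec,
      dotProduct_sub, hq1, sub_zero] at hc
    exact hc
  · -- the span is reachable
    intro y hy
    rw [← Subspace.forall_mem_dualAnnihilator_apply_eq_zero_iff]
    intro q hq
    rw [Submodule.mem_dualAnnihilator] at hq
    obtain ⟨w, hw⟩ := hdual q
    have main := dual_c hT h0I hTI hN hN0 (Matrix.vecMul w (P T)) (Matrix.vecMul w 𝒞) (by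
      intro u u' hu0 hu' hu
      have hcont : ∀ a, ContinuousOn (fun t => (N 0 t).mulVec (u t) a) (Set.Ioo (-ε) (T + ε)) :=
        fun a t ht => (md_mulVec (hN 0 t ht) (hu t ht) a).continuousAt.continuousWithinAt
      choose G hG0 hG using fun a => antideriv h0I (hcont a)
      refine ⟨fun t a => G a t, funext hG0, fun t ht a => hG a t ht, ?_⟩
      rw [← Matrix.dotProduct_mulVec, ← Matrix.dotProduct_mulVec, ← dotProduct_add, ← hw]
      refine hq _ ⟨u, u', fun t => 𝒞.mulVec (u t) + (P t).mulVec (fun a => G a t), hu0, ?_, ?_,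
        ?_, ?_, rfl⟩
      · exact continuousOn_pi.2 fun j => (hu' j).mono hsub
      · exact fun t ht => hu t (hsub ht)
      · intro t ht a
        have ht' := hsub ht
        refine ((md_cmulVec 𝒞 (hu t ht') a).add
          (md_mulVec (x := fun t a => G a t) (x' := (N 0 t).mulVec (u t))
            (hP t ht') (fun a => hG a t ht') a)).congr_deriv ?_
        have e : (P t).mulVec ((N 0 t).mulVec (u t)) =
            (ℬ t).mulVec (u t) + (𝒜 t).mulVec (𝒞.mulVec (u t)) := by
          rw [hNdef, Matrix.mulVec_mulVec, ← Matrix.mul_assoc, hPQ t ht', Matrix.one_mul, hM0,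
            Matrix.add_mulVec, Matrix.mulVec_mulVec]
        rw [e]
        simp only [Pi.add_apply, Matrix.mulVec_add, Matrix.mulVec_mulVec]
        ring
      · have : (fun a => G a 0) = (0 : Fin n → ℝ) := funext hG0
        simp only [hu0, this, Matrix.mulVec_zero, add_zero])
    obtain ⟨m1, m2⟩ := main
    have : Submodule.span ℝ
          ({y : Fin n → ℝ | ∃ v : Fin mm → ℝ, y = 𝒞.mulVec v} ∪
           {y : Fin n → ℝ | ∃ (i : ℕ) (v : Fin mm → ℝ),
             y = (φ T t₀ * ℳ i t₀).mulVec v}) ≤ LinearMap.ker q := by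
      rw [Submodule.span_le]
      rintro _ (⟨v, rfl⟩ | ⟨i, v, rfl⟩)
      · rw [SetLike.mem_coe, LinearMap.mem_ker, hw, Matrix.dotProduct_mulVec, m1, zero_dotProduct]
      · have := m2 i t₀ ht₀I
        simp only [hNdef, hQ0, Matrix.one_mul, Matrix.vecMul_vecMul] at this
        rw [SetLike.mem_coe, LinearMap.mem_ker, hw, Matrix.dotProduct_mulVec]
        change dotProduct (Matrix.vecMul w (P T * ℳ i t₀)) v = 0
        rw [this, zero_dotProduct]
    exact this hy
end
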